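/- arXiv:2307.02501 — 5 statements merged into one kernel-verified Lean document; each statement's English description precedes it below -/
import Mathlib

section
/- In-expectation part of the key technical lemma: Let A : Z^n → Θ be a deterministic measurable learning algorithm and suppose the loss ℓ is bounded. Let S^n ∼ D^n be an i.i.d. sample and θ̂ = A(S^n). Then E_{S^n}[R(θ̂) − R̂(θ̂, S^n)] ≤ 2 E_{S⁻,S⁺}[Rad(Θ̂ⁿ, S⁺)], where S⁻ and S⁺ are two independent i.i.d. size-n samples from D and Θ̂ⁿ = {A(S_σ) : σ ∈ {−1,+1}ⁿ}. -/
open MeasureTheory Real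

noncomputable def empRisk {X Z : Type*} (ℓ : X → Z → ℝ) {n : ℕ} (θ : X) (S : Fin n → Z) : ℝ :=
  (n : ℝ)⁻¹ * ∑ i, ℓ θ (S i)

noncomputable def risk {X Z : Type*} [MeasurableSpace Z] (ℓ : X → Z → ℝ) (D : Measure Z)
    (θ : X) : ℝ :=
  ∫ z, ℓ θ z ∂D

/-- Empirical Rademacher complexity of the set `C` on the sample `S`:
`(1/n) E_σ [ max_{θ ∈ C} ∑ i σ i ℓ(θ, Z i) ]`, with the expectation over uniform sign
vectors written as an average over all `2^n` sign patterns (`true ↔ +1`). -/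
noncomputable def rad {X Z : Type*} (ℓ : X → Z → ℝ) {n : ℕ} (C : Set X) (S : Fin n → Z) : ℝ :=
  (n : ℝ)⁻¹ * ((2 ^ n : ℝ)⁻¹ *
    ∑ σ : Fin n → Bool, sSup ((fun θ => ∑ i, (if σ i then (1 : ℝ) else -1) * ℓ θ (S i)) '' C))

/-- The mixed sample `S_σ`: the `i`-th point is taken from `Sp` if `σ i = +1` (`true`),
and from `Sm` if `σ i = -1` (`false`). -/
def mix {Z : Type*} {n : ℕ} (Sm Sp : Fin n → Z) (σ : Fin n → Bool) : Fin n → Z :=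
  fun i => if σ i then Sp i else Sm i

/-- The algorithm- and data-dependent set `Θ̂ⁿ = {A(S_σ) : σ ∈ {-1,+1}ⁿ}`. -/
def hatTheta {X Z : Type*} {n : ℕ} (A : (Fin n → Z) → X) (Sm Sp : Fin n → Z) : Set X :=
  Set.range fun σ : Fin n → Bool => A (mix Sm Sp σ)

/-- Exchanging the entries of two i.i.d. samples at the coordinates where `σ` is `false`
preserves their joint law. -/
theorem measurePreserving_mix {Z : Type*} [MeasurableSpace Z] (D : Measure Z)
    [IsProbabilityMeasure D] {n : ℕ} (σ : Fin n → Bool) :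
    MeasurePreserving
      (fun p : (Fin n → Z) × (Fin n → Z) => (mix p.2 p.1 σ, mix p.1 p.2 σ))
      ((Measure.pi fun _ : Fin n => D).prod (Measure.pi fun _ : Fin n => D))
      ((Measure.pi fun _ : Fin n => D).prod (Measure.pi fun _ : Fin n => D)) := by
  have he := measurePreserving_arrowProdEquivProdArrow Z Z (Fin n) (fun _ => D) (fun _ => D)
  have hf : ∀ i, MeasurePreserving (if σ i then id else Prod.swap : Z × Z → Z × Z)
      (D.prod D) (D.prod D) := by
    intro i
    split_ifs
    · exact MeasurePreserving.id _
    · exact Measure.measurePreserving_swap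
  convert (he.comp (measurePreserving_pi _ _ hf)).comp he.symm using 1
  funext p
  refine Prod.ext ?_ ?_ <;> funext i <;>
    cases h : σ i <;>
    simp [mix, h, MeasurableEquiv.arrowProdEquivProdArrow, Equiv.arrowProdEquivProdArrow]

theorem hatTheta_comm {X Z : Type*} {n : ℕ} (A : (Fin n → Z) → X) (S T : Fin n → Z) :
    hatTheta A S T = hatTheta A T S := by
  have key : ∀ S T : Fin n → Z, hatTheta A S T ⊆ hatTheta A T S := by
    rintro S T _ ⟨σ, rfl⟩
    refine ⟨fun i => !σ i, ?_⟩
    refine congrArg A (funext fun i => ?_)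
    cases h : σ i <;> simp [mix, h]
  exact (key S T).antisymm (key T S)

theorem rad_hatTheta_eq {X Z : Type*} (ℓ : X → Z → ℝ) {n : ℕ} (A : (Fin n → Z) → X)
    (Sm Sp S : Fin n → Z) :
    rad ℓ (hatTheta A Sm Sp) S = (n : ℝ)⁻¹ * ((2 ^ n : ℝ)⁻¹ * ∑ σ : Fin n → Bool,
      ⨆ τ : Fin n → Bool, ∑ i, (if σ i then (1 : ℝ) else -1) * ℓ (A (mix Sm Sp τ)) (S i)) := by
  simp only [rad, hatTheta, ← Set.range_comp]
  rfl

/-- The symmetrized generalization gap is at most the sum of the two Rademacher complexities. -/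
theorem sum_empRisk_mix_sub_le {X Z : Type*} (ℓ : X → Z → ℝ) {n : ℕ} (A : (Fin n → Z) → X)
    (Sm Sp : Fin n → Z) :
    ∑ σ : Fin n → Bool, (empRisk ℓ (A (mix Sm Sp σ)) (mix Sp Sm σ) -
        empRisk ℓ (A (mix Sm Sp σ)) (mix Sm Sp σ)) ≤
      2 ^ n * (rad ℓ (hatTheta A Sm Sp) Sm + rad ℓ (hatTheta A Sm Sp) Sp) := by
  let F : (Fin n → Z) → (Fin n → Bool) → (Fin n → Bool) → ℝ := fun S σ τ =>
    ∑ i, (if σ i then (1 : ℝ) else -1) * ℓ (A (mix Sm Sp τ)) (S i)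
  have hle : ∀ S σ τ, F S σ τ ≤ ⨆ τ, F S σ τ := fun S σ τ =>
    le_ciSup (Set.finite_range (F S σ)).bddAbove τ
  have hrad : ∀ S, 2 ^ n * rad ℓ (hatTheta A Sm Sp) S = ∑ σ, (n : ℝ)⁻¹ * ⨆ τ, F S σ τ := by
    intro S
    rw [rad_hatTheta_eq, ← Finset.mul_sum]
    have : (2 ^ n : ℝ) ≠ 0 := by positivity
    field_simp
    rfl
  have hneg : ∑ σ : Fin n → Bool, (n : ℝ)⁻¹ * ⨆ τ, F Sp σ τ =
      ∑ σ : Fin n → Bool, (n : ℝ)⁻¹ * ⨆ τ, F Sp (fun i => !σ i) τ :=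
    (Equiv.sum_comp (Equiv.arrowCongr (Equiv.refl (Fin n)) Equiv.boolNot)
      fun σ => (n : ℝ)⁻¹ * ⨆ τ, F Sp σ τ).symm
  rw [mul_add, hrad, hrad, hneg, ← Finset.sum_add_distrib]
  refine Finset.sum_le_sum fun σ _ => ?_
  have hgap : empRisk ℓ (A (mix Sm Sp σ)) (mix Sp Sm σ) -
      empRisk ℓ (A (mix Sm Sp σ)) (mix Sm Sp σ) =
      (n : ℝ)⁻¹ * (F Sm σ σ + F Sp (fun i => !σ i) σ) := by
    simp only [empRisk, F, ← mul_sub, ← Finset.sum_sub_distrib, ← Finset.sum_add_distrib]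
    congr 1
    refine Finset.sum_congr rfl fun i _ => ?_
    generalize A (mix Sm Sp σ) = θ
    by_cases h : σ i = true <;> simp [mix, h] <;> ring
  rw [hgap, ← mul_add]
  gcongr <;> exact hle _ _ _

section Measurability

variable {Z Θ : Type*} [MeasurableSpace Z] [MeasurableSpace Θ]

theorem measurable_mix {n : ℕ} (σ : Fin n → Bool) :
    Measurable fun p : (Fin n → Z) × (Fin n → Z) => mix p.1 p.2 σ := by
  refine measurable_pi_lambda _ fun i => ?_
  cases h : σ i <;> simp only [mix, h] <;> simp <;> fun_prop

theorem abs_sum_signs_mul_le {ι : Type*} [Fintype ι] {B : ℝ} (s : ι → Bool) {f : ι → ℝ}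
    (hf : ∀ i, |f i| ≤ B) :
    |∑ i, (if s i then (1 : ℝ) else -1) * f i| ≤ Fintype.card ι * B := by
  refine (Finset.abs_sum_le_sum_abs _ _).trans ?_
  have : ∀ i, |(if s i then (1 : ℝ) else -1) * f i| ≤ B := fun i => by
    cases h : s i <;> simpa [h] using hf i
  simpa using Finset.sum_le_sum fun i (_ : i ∈ Finset.univ) => this i

theorem abs_ciSup_le {ι : Type*} [Nonempty ι] [Finite ι] {f : ι → ℝ} {C : ℝ}
    (hf : ∀ i, |f i| ≤ C) : |⨆ i, f i| ≤ C := by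
  obtain ⟨i, hi⟩ := exists_eq_ciSup_of_finite (f := f)
  exact hi ▸ hf i

theorem integrable_rad_hatTheta {n : ℕ} (μ : Measure ((Fin n → Z) × (Fin n → Z)))
    [IsFiniteMeasure μ] {ℓ : Θ → Z → ℝ} (hℓ : Measurable (Function.uncurry ℓ))
    {B : ℝ} (hB : ∀ θ z, |ℓ θ z| ≤ B) {A : (Fin n → Z) → Θ} (hA : Measurable A)
    {S : (Fin n → Z) × (Fin n → Z) → Fin n → Z} (hS : Measurable S) :
    Integrable (fun p => rad ℓ (hatTheta A p.1 p.2) (S p)) μ := by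
  simp only [rad_hatTheta_eq]
  refine ((integrable_finsetSum _ fun σ _ => ?_).const_mul _).const_mul _
  refine Integrable.of_bound (Measurable.aestronglyMeasurable ?_) (n * B) (ae_of_all _ fun p => ?_)
  · refine Measurable.iSup fun τ => Finset.measurable_sum _ fun i _ => ?_
    exact (hℓ.comp ((hA.comp (measurable_mix τ)).prodMk
      ((measurable_pi_apply i).comp hS))).const_mul _
  · refine abs_ciSup_le fun τ => ?_
    simpa using abs_sum_signs_mul_le σ fun i => hB (A (mix p.1 p.2 τ)) (S p i)

theorem integrable_empRisk {Ω : Type*} [MeasurableSpace Ω] (μ : Measure Ω) [IsFiniteMeasure μ]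
    {ℓ : Θ → Z → ℝ} (hℓ : Measurable (Function.uncurry ℓ)) {B : ℝ} (hB : ∀ θ z, |ℓ θ z| ≤ B)
    {n : ℕ} {θ : Ω → Θ} (hθ : Measurable θ) {S : Ω → Fin n → Z} (hS : Measurable S) :
    Integrable (fun ω => empRisk ℓ (θ ω) (S ω)) μ := by
  refine (integrable_finsetSum _ fun i _ => ?_).const_mul _
  exact Integrable.of_bound
    (hℓ.comp (hθ.prodMk ((measurable_pi_apply i).comp hS))).aestronglyMeasurable B
    (ae_of_all _ fun ω => hB _ _)

/-- The empirical risk of a fixed parameter is an unbiased estimate of its risk. -/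
theorem integral_empRisk (D : Measure Z) [IsProbabilityMeasure D] {n : ℕ} (hn : 0 < n)
    {ℓ : Θ → Z → ℝ} (hℓ : Measurable (Function.uncurry ℓ)) {B : ℝ} (hB : ∀ θ z, |ℓ θ z| ≤ B)
    (θ : Θ) :
    ∫ S, empRisk ℓ θ S ∂(Measure.pi fun _ : Fin n => D) = risk ℓ D θ := by
  have hm : Measurable (ℓ θ) := hℓ.comp measurable_prodMk_left
  have hn' : (n : ℝ) ≠ 0 := by positivity
  simp only [empRisk]
  rw [integral_const_mul, integral_finsetSum]
  · simp only [integral_comp_eval (μ := fun _ : Fin n => D) hm.aestronglyMeasurable]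
    simp [risk, hn']
  · intro i _
    exact Integrable.of_bound (hm.comp (measurable_pi_apply i)).aestronglyMeasurable B
      (ae_of_all _ fun S => hB _ _)

end Measurability

/-- in-expectation part of the key technical lemma.
For a deterministic measurable algorithm `A` and a bounded measurable loss,
`E_{Sⁿ}[R(θ̂) − R̂(θ̂, Sⁿ)] ≤ 2 E_{S⁻,S⁺}[Rad(Θ̂ⁿ, S⁺)]`, where `θ̂ = A(Sⁿ)`,
`Sⁿ ~ Dⁿ`, and `S⁻, S⁺` are two independent i.i.d. size-`n` samples from `D`. -/
theorem stmt_0 {Z Θ : Type*} [MeasurableSpace Z] [MeasurableSpace Θ]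
    (D : Measure Z) [IsProbabilityMeasure D] (n : ℕ) (hn : 0 < n)
    (ℓ : Θ → Z → ℝ) (hℓmeas : Measurable (Function.uncurry ℓ))
    (B : ℝ) (hbdd : ∀ θ z, |ℓ θ z| ≤ B)
    (A : (Fin n → Z) → Θ) (hA : Measurable A) :
    ∫ S, (risk ℓ D (A S) - empRisk ℓ (A S) S) ∂(Measure.pi fun _ : Fin n => D) ≤
      2 * ∫ p : (Fin n → Z) × (Fin n → Z), rad ℓ (hatTheta A p.1 p.2) p.2
        ∂((Measure.pi fun _ : Fin n => D).prod (Measure.pi fun _ : Fin n => D)) := by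
  set P := Measure.pi fun _ : Fin n => D with hP
  let gap : (Fin n → Z) × (Fin n → Z) → ℝ := fun p =>
    empRisk ℓ (A p.2) p.1 - empRisk ℓ (A p.2) p.2
  have hgap : Integrable gap (P.prod P) :=
    (integrable_empRisk _ hℓmeas hbdd (hA.comp measurable_snd) measurable_fst).sub
      (integrable_empRisk _ hℓmeas hbdd (hA.comp measurable_snd) measurable_snd)
  have hghost : ∫ S, (risk ℓ D (A S) - empRisk ℓ (A S) S) ∂P = ∫ p, gap p ∂(P.prod P) := by
    rw [integral_prod_symm _ hgap]
    refine integral_congr_ae (ae_of_all _ fun S => ?_)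
    simp only [gap]
    rw [integral_sub (integrable_empRisk _ hℓmeas hbdd (S := fun S' => S') measurable_const
      measurable_id) (integrable_const _), integral_empRisk D hn hℓmeas hbdd]
    simp
  have hmix : ∀ σ, ∫ p : (Fin n → Z) × (Fin n → Z),
      gap (mix p.2 p.1 σ, mix p.1 p.2 σ) ∂(P.prod P) = ∫ p, gap p ∂(P.prod P) := by
    intro σ
    have h := measurePreserving_mix D σ
    conv_rhs => rw [hP, ← h.map_eq]
    rw [integral_map h.measurable.aemeasurable (by rw [h.map_eq]; exact hgap.1)]
  have hrad₁ : Integrable (fun p => rad ℓ (hatTheta A p.1 p.2) p.1) (P.prod P) :=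
    integrable_rad_hatTheta _ hℓmeas hbdd hA measurable_fst
  have hrad₂ : Integrable (fun p => rad ℓ (hatTheta A p.1 p.2) p.2) (P.prod P) :=
    integrable_rad_hatTheta _ hℓmeas hbdd hA measurable_snd
  have hswap : ∫ p : (Fin n → Z) × (Fin n → Z), rad ℓ (hatTheta A p.1 p.2) p.1 ∂(P.prod P) =
      ∫ p : (Fin n → Z) × (Fin n → Z), rad ℓ (hatTheta A p.1 p.2) p.2 ∂(P.prod P) := by
    rw [← integral_prod_swap]
    simp only [Prod.fst_swap, Prod.snd_swap]
    refine integral_congr_ae (ae_of_all _ fun p => ?_)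
    simp only [hatTheta_comm A p.2 p.1]
  have hint : ∀ σ, Integrable (fun p : (Fin n → Z) × (Fin n → Z) =>
      gap (mix p.2 p.1 σ, mix p.1 p.2 σ)) (P.prod P) := fun σ =>
    (measurePreserving_mix D σ).integrable_comp_of_integrable hgap
  have hmain : 2 ^ n * ∫ p, gap p ∂(P.prod P) ≤
      2 ^ n * (2 * ∫ p, rad ℓ (hatTheta A p.1 p.2) p.2 ∂(P.prod P)) :=
    calc 2 ^ n * ∫ p, gap p ∂(P.prod P)
        = ∫ p : (Fin n → Z) × (Fin n → Z), ∑ σ : Fin n → Bool,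
            gap (mix p.2 p.1 σ, mix p.1 p.2 σ) ∂(P.prod P) := by
          rw [integral_finsetSum _ fun σ _ => hint σ]
          simp [hmix]
      _ ≤ ∫ p : (Fin n → Z) × (Fin n → Z), 2 ^ n * (rad ℓ (hatTheta A p.1 p.2) p.1 +
            rad ℓ (hatTheta A p.1 p.2) p.2) ∂(P.prod P) :=
          integral_mono (integrable_finsetSum _ fun σ _ => hint σ)
            ((hrad₁.add hrad₂).const_mul _) fun p => sum_empRisk_mix_sub_le ℓ A p.1 p.2
      _ = 2 ^ n * (2 * ∫ p, rad ℓ (hatTheta A p.1 p.2) p.2 ∂(P.prod P)) := by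
          rw [integral_const_mul, integral_add hrad₁ hrad₂, hswap, two_mul]
  rw [hghost]
  exact le_of_mul_le_mul_left hmain (by positivity)
end

section
/- Dimension-independent generalization bound for projected SGD: Suppose the loss ℓ : Θ × Z → ℝ takes values in [a, a+b], is α-strongly convex and β-smooth in θ for every z, and is L-weakly Lipschitz continuous, and that Θ ⊂ ℝ^k is compact and convex with diameter Δ(Θ) ≤ R. Consider projected SGD with updates θ̂_{t+1} = Π_Θ(θ̂_t − η∇ℓ(θ̂_t, Z_{i_t})), initialization θ₁ ∈ Θ, step size η ∈ (0, 2/β), fixed indices i₁,…,i_T ∈ {1,…,n}, and output θ̂ = θ̂_{T+1}. Let γ = √(1 − 2αη + αβη²). Then for any δ ∈ (0,1], with probability at least 1 − δ over an i.i.d. sample S^n ∼ D^n, R(θ̂) − R̂(θ̂, S^n) ≤ 4b·√( max{⌈ln(2Rn)/ln(1/γ)⌉·ln 2, 0} / n ) + b·√(8 ln(2/δ)/n) + 2L/n. -/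
open MeasureTheory Real
open scoped RealInnerProductSpace

/-- Projected SGD iterates: `θ̂₁ = θ₁` and `θ̂_{t+1} = Π_Θ(θ̂_t − η ∇ℓ(θ̂_t, Z_{i_t}))`,
where `proj` is the projection onto the parameter set and `idx t` is the index of the data
point used at step `t`.  `sgdIter … t` is the iterate `θ̂_{t+1}` (0-based recursion). -/
noncomputable def sgdIter {k : ℕ} {Z : Type*}
    (proj : EuclideanSpace ℝ (Fin k) → EuclideanSpace ℝ (Fin k))
    (ℓ : EuclideanSpace ℝ (Fin k) → Z → ℝ) (η : ℝ) {n : ℕ} (S : Fin n → Z)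
    (idx : ℕ → Fin n) (θ₁ : EuclideanSpace ℝ (Fin k)) : ℕ → EuclideanSpace ℝ (Fin k)
  | 0 => θ₁
  | t + 1 =>
      proj (sgdIter proj ℓ η S idx θ₁ t -
        η • gradient (fun θ => ℓ θ (S (idx t))) (sgdIter proj ℓ η S idx θ₁ t))

theorem Submodule.real_inner_starProjection_left {E : Type*} [NormedAddCommGroup E] [InnerProductSpace ℝ E]
    (V : Submodule ℝ E) [V.HasOrthogonalProjection] {v : E} (hv : v ∈ V) (u : E) :
    ⟪V.starProjection u, v⟫ = ⟪u, v⟫ := by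
  have := V.starProjection_inner_eq_zero u v hv
  rw [inner_sub_left] at this
  linarith

theorem Submodule.norm_starProjection_le {E : Type*} [NormedAddCommGroup E] [InnerProductSpace ℝ E]
    (V : Submodule ℝ E) [V.HasOrthogonalProjection] (u : E) : ‖V.starProjection u‖ ≤ ‖u‖ := by
  simpa using V.starProjection.le_of_opNorm_le V.starProjection_norm_le u

section FirstOrder

variable {E : Type*} [NormedAddCommGroup E] [InnerProductSpace ℝ E] [CompleteSpace E]
  {K : Set E} {f : E → ℝ} {G : E → E} {V : Submodule ℝ E} {β η ρ : ℝ}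

theorem Convex.le_linearization_add_of_inner_sub_le (hK : Convex ℝ K)
    (hf : ∀ x ∈ K, HasGradientAt f (G x) x) {x y : E} (hx : x ∈ K) (hy : y ∈ K) {C : ℝ}
    (hC : ∀ s ∈ Set.Icc (0 : ℝ) 1, ⟪G (x + s • (y - x)) - G x, y - x⟫ ≤ C * s) :
    f y ≤ f x + ⟪G x, y - x⟫ + C / 2 := by
  have hmem : ∀ s ∈ Set.Icc (0 : ℝ) 1, x + s • (y - x) ∈ K := fun s hs =>
    hK.add_smul_sub_mem hx hy hs
  have hd : ∀ s ∈ Set.Icc (0 : ℝ) 1,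
      HasDerivAt (fun s : ℝ => f (x + s • (y - x)) - s * ⟪G x, y - x⟫ - C / 2 * s ^ 2)
        (⟪G (x + s • (y - x)), y - x⟫ - ⟪G x, y - x⟫ - C * s) s := by
    intro s hs
    have h1 : HasDerivAt (fun s : ℝ => x + s • (y - x)) (y - x) s := by
      simpa using ((hasDerivAt_id s).smul_const (y - x)).const_add x
    have h2 := (hasGradientAt_iff_hasFDerivAt.1 (hf _ (hmem s hs))).comp_hasDerivAt s h1
    have h3 := (h2.sub ((hasDerivAt_id s).mul_const ⟪G x, y - x⟫)).sub
      (((hasDerivAt_id s).pow 2).const_mul (C / 2))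
    refine h3.congr_deriv ?_
    rw [InnerProductSpace.toDual_apply_apply]
    simp only [id]
    push_cast
    ring
  have hanti := antitoneOn_of_deriv_nonpos (convex_Icc (0 : ℝ) 1)
    (fun s hs => (hd s hs).continuousAt.continuousWithinAt)
    (fun s hs => (hd s (interior_subset hs)).differentiableAt.differentiableWithinAt)
    (fun s hs => by
      rw [(hd s (interior_subset hs)).deriv]
      have := hC s (interior_subset hs)
      rw [inner_sub_left] at this
      linarith)
  have := hanti (Set.left_mem_Icc.2 zero_le_one) (Set.right_mem_Icc.2 zero_le_one) zero_le_one
  simp at this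
  linarith

theorem Convex.linearization_le_of_monotone (hK : Convex ℝ K)
    (hf : ∀ x ∈ K, HasGradientAt f (G x) x)
    (hmono : ∀ x ∈ K, ∀ y ∈ K, 0 ≤ ⟪G x - G y, x - y⟫) {x y : E} (hx : x ∈ K) (hy : y ∈ K) :
    f x + ⟪G x, y - x⟫ ≤ f y := by
  have hf' : ∀ x ∈ K, HasGradientAt (fun x => -f x) (-G x) x := fun x hx => by
    rw [hasGradientAt_iff_hasFDerivAt, map_neg]
    exact (hasGradientAt_iff_hasFDerivAt.1 (hf x hx)).neg
  have := hK.le_linearization_add_of_inner_sub_le hf' hx hy (C := 0) (fun s hs => by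
    rcases hs.1.eq_or_lt with h0 | h0
    · simp [← h0]
    have h1 := hmono _ (hK.add_smul_sub_mem hx hy hs) x hx
    rw [add_sub_cancel_left, inner_smul_right] at h1
    have h2 := nonneg_of_mul_nonneg_right h1 h0
    have h3 : -G (x + s • (y - x)) - -G x = -(G (x + s • (y - x)) - G x) := by abel
    rw [h3, inner_neg_left]
    linarith)
  rw [inner_neg_left] at this
  linarith

theorem Convex.le_linearization_add_of_lipschitz (hK : Convex ℝ K)
    (hf : ∀ x ∈ K, HasGradientAt f (G x) x)
    (hlip : ∀ x ∈ K, ∀ y ∈ K, ‖G x - G y‖ ≤ β * ‖x - y‖) {x y : E} (hx : x ∈ K) (hy : y ∈ K) :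
    f y ≤ f x + ⟪G x, y - x⟫ + β / 2 * ‖y - x‖ ^ 2 := by
  have := hK.le_linearization_add_of_inner_sub_le hf hx hy (C := β * ‖y - x‖ ^ 2) (fun s hs => by
    have h1 := hlip _ (hK.add_smul_sub_mem hx hy hs) x hx
    rw [add_sub_cancel_left, norm_smul, Real.norm_of_nonneg hs.1] at h1
    calc _ ≤ ‖G (x + s • (y - x)) - G x‖ * ‖y - x‖ := real_inner_le_norm _ _
      _ ≤ β * (s * ‖y - x‖) * ‖y - x‖ := by gcongr
      _ = _ := by ring)
  linarith

variable [V.HasOrthogonalProjection]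

/-- A convex function with `β`-Lipschitz gradient exceeds its linearization quadratically in the
gradient increment, provided there is enough room around one endpoint. -/
theorem Convex.linearization_add_sq_le (hK : Convex ℝ K)
    (hβ : 0 < β) (hf : ∀ x ∈ K, HasGradientAt f (G x) x)
    (hmono : ∀ x ∈ K, ∀ y ∈ K, 0 ≤ ⟪G x - G y, x - y⟫)
    (hlip : ∀ x ∈ K, ∀ y ∈ K, ‖G x - G y‖ ≤ β * ‖x - y‖) {p q : E} (hp : p ∈ K) (hq : q ∈ K)
    (hroom : ∀ v ∈ V, ‖v‖ ≤ ‖p - q‖ → q + v ∈ K) :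
    f p + ⟪G p, q - p⟫ + (2 * β)⁻¹ * ‖V.starProjection (G p - G q)‖ ^ 2 ≤ f q := by
  set w := V.starProjection (G p - G q) with hw
  have hwV : w ∈ V := V.starProjection_apply_mem _
  have hu : q + β⁻¹ • w ∈ K := by
    refine hroom _ (V.smul_mem _ hwV) ?_
    rw [norm_smul, norm_inv, Real.norm_of_nonneg hβ.le, inv_mul_le_iff₀ hβ]
    exact (V.norm_starProjection_le _).trans (hlip p hp q hq)
  have h1 := hK.linearization_le_of_monotone hf hmono hp hu
  have h2 := hK.le_linearization_add_of_lipschitz hf hlip hq hu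
  have h3 : ⟪G p, w⟫ - ⟪G q, w⟫ = ‖w‖ ^ 2 := by
    rw [← inner_sub_left, ← V.real_inner_starProjection_left hwV, real_inner_self_eq_norm_sq]
  rw [add_sub_cancel_left, norm_smul, norm_inv, Real.norm_of_nonneg hβ.le, inner_smul_right] at h2
  rw [add_sub_right_comm, inner_add_right, inner_smul_right] at h1
  have h4 : β / 2 * (β⁻¹ * ‖w‖) ^ 2 = (2 * β)⁻¹ * ‖w‖ ^ 2 := by field_simp
  have h5 : β⁻¹ * ⟪G p, w⟫ - β⁻¹ * ⟪G q, w⟫ = 2 * ((2 * β)⁻¹ * ‖w‖ ^ 2) := by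
    rw [← mul_sub, h3]; field_simp
  linarith

theorem Convex.norm_gradient_step_sub_le_of_room (hK : Convex ℝ K)
    (hV : ∀ x ∈ K, ∀ y ∈ K, y - x ∈ V) {α : ℝ} (hα : 0 ≤ α) (hβ : 0 < β)
    (hf : ∀ x ∈ K, HasGradientAt f (G x) x)
    (hmono : ∀ x ∈ K, ∀ y ∈ K, α * ‖x - y‖ ^ 2 ≤ ⟪G x - G y, x - y⟫)
    (hlip : ∀ x ∈ K, ∀ y ∈ K, ‖G x - G y‖ ≤ β * ‖x - y‖) (hη : 0 ≤ η) (hηβ : η * β ≤ 2)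
    {p q : E} (hp : p ∈ K) (hq : q ∈ K)
    (hroom_p : ∀ v ∈ V, ‖v‖ ≤ ‖p - q‖ → p + v ∈ K)
    (hroom_q : ∀ v ∈ V, ‖v‖ ≤ ‖p - q‖ → q + v ∈ K) :
    ‖(p - q) - η • V.starProjection (G p - G q)‖ ≤
      Real.sqrt (1 - 2 * α * η + α * β * η ^ 2) * ‖p - q‖ := by
  have hmono' : ∀ x ∈ K, ∀ y ∈ K, 0 ≤ ⟪G x - G y, x - y⟫ := fun x hx y hy =>
    le_trans (by positivity) (hmono x hx y hy)
  have h1 := hK.linearization_add_sq_le hβ hf hmono' hlip hp hq hroom_q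
  have h2 := hK.linearization_add_sq_le hβ hf hmono' hlip hq hp
    (by simpa only [norm_sub_rev q p] using hroom_p)
  have h3 : ‖V.starProjection (G q - G p)‖ = ‖V.starProjection (G p - G q)‖ := by
    rw [← norm_neg, ← map_neg, neg_sub]
  have h4 := hmono p hp q hq
  have h5 : ⟪G p, q - p⟫ = -⟪G p, p - q⟫ := by rw [← inner_neg_right, neg_sub]
  have h6 : ⟪p - q, V.starProjection (G p - G q)⟫ = ⟪G p - G q, p - q⟫ := by
    rw [real_inner_comm, V.real_inner_starProjection_left (hV q hq p hp)]
  rw [h3] at h2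
  rw [h5] at h1
  set W := ‖V.starProjection (G p - G q)‖ ^ 2
  set I := ⟪G p - G q, p - q⟫ with hI
  rw [inner_sub_left] at hI
  have hco : W ≤ β * I := by
    have : 2 * ((2 * β)⁻¹ * W) ≤ I := by linarith
    have h7 : 2 * ((2 * β)⁻¹ * W) = β⁻¹ * W := by field_simp
    rwa [h7, inv_mul_le_iff₀ hβ] at this
  rw [← Real.sqrt_sq (norm_nonneg (p - q)), ← Real.sqrt_mul' _ (sq_nonneg _)]
  apply Real.le_sqrt_of_sq_le
  rw [norm_sub_sq_real, inner_smul_right, h6, norm_smul, mul_pow, Real.norm_of_nonneg hη]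
  change ‖p - q‖ ^ 2 - 2 * (η * I) + η ^ 2 * W ≤ _
  have h8 : η ^ 2 * W ≤ η ^ 2 * (β * I) := by gcongr
  have h9 : 0 ≤ (η * (2 - η * β)) * (I - α * ‖p - q‖ ^ 2) :=
    mul_nonneg (mul_nonneg hη (by linarith)) (by linarith)
  nlinarith

theorem Convex.norm_gradient_step_sub_le_of_interior (hK : Convex ℝ K)
    (hV : ∀ x ∈ K, ∀ y ∈ K, y - x ∈ V) {α : ℝ} (hα : 0 ≤ α) (hβ : 0 < β)
    (hf : ∀ x ∈ K, HasGradientAt f (G x) x)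
    (hmono : ∀ x ∈ K, ∀ y ∈ K, α * ‖x - y‖ ^ 2 ≤ ⟪G x - G y, x - y⟫)
    (hlip : ∀ x ∈ K, ∀ y ∈ K, ‖G x - G y‖ ≤ β * ‖x - y‖) (hη : 0 ≤ η) (hηβ : η * β ≤ 2)
    {x y : E} (hρ : 0 < ρ) (hroom_x : ∀ v ∈ V, ‖v‖ ≤ ρ → x + v ∈ K)
    (hroom_y : ∀ v ∈ V, ‖v‖ ≤ ρ → y + v ∈ K) :
    ‖(x - y) - η • V.starProjection (G x - G y)‖ ≤
      Real.sqrt (1 - 2 * α * η + α * β * η ^ 2) * ‖x - y‖ := by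
  obtain ⟨m, hm⟩ := exists_nat_gt (‖x - y‖ / ρ)
  have hm0 : (0 : ℝ) < m := lt_of_le_of_lt (by positivity) hm
  set u : ℕ → E := fun i => x + ((i : ℝ) / m) • (y - x) with hu
  have hu0 : u 0 = x := by simp [hu]
  have hum : u m = y := by simp [hu, hm0.ne']
  have hroom : ∀ i ≤ m, ∀ v ∈ V, ‖v‖ ≤ ρ → u i + v ∈ K := by
    intro i hi v hv hvρ
    have := hK.add_smul_sub_mem (hroom_x v hv hvρ) (hroom_y v hv hvρ) (t := (i : ℝ) / m)
      ⟨by positivity, by rw [div_le_one hm0]; exact_mod_cast hi⟩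
    convert this using 1
    simp only [hu, add_sub_add_right_eq_sub]
    abel
  have hmem : ∀ i ≤ m, u i ∈ K := fun i hi => by
    simpa using hroom i hi 0 V.zero_mem (by simpa using hρ.le)
  have hstep : ∀ i, u i - u (i + 1) = (m : ℝ)⁻¹ • (x - y) := by
    intro i
    simp only [hu, add_sub_add_left_eq_sub, ← sub_smul]
    rw [← neg_sub x y, smul_neg, ← neg_smul]
    congr 1
    push_cast
    field_simp
    ring
  have hnorm : ∀ i, ‖u i - u (i + 1)‖ = ‖x - y‖ / m := by
    intro i
    rw [hstep, norm_smul, norm_inv, Real.norm_of_nonneg hm0.le]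
    ring
  have hsmall : ‖x - y‖ / m ≤ ρ := by
    rw [div_lt_iff₀ hρ] at hm
    rw [div_le_iff₀ hm0]
    linarith
  have key := dist_le_range_sum_of_dist_le (f := fun i => u i - η • V.starProjection (G (u i))) m
    (d := fun _ => Real.sqrt (1 - 2 * α * η + α * β * η ^ 2) * (‖x - y‖ / m)) (by
      intro i hi
      have := hK.norm_gradient_step_sub_le_of_room hV hα hβ hf hmono hlip hη hηβ
        (hmem i hi.le) (hmem (i + 1) hi)
        (fun v hv h => hroom i hi.le v hv (h.trans ((hnorm i).le.trans hsmall)))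
        (fun v hv h => hroom (i + 1) hi v hv (h.trans ((hnorm i).le.trans hsmall)))
      rw [hnorm] at this
      rw [dist_eq_norm]
      refine (congrArg norm ?_).trans_le this
      rw [map_sub, smul_sub]
      abel)
  simp only [hu0, hum, Finset.sum_const, Finset.card_range, nsmul_eq_mul, dist_eq_norm] at key
  calc _ = ‖x - η • V.starProjection (G x) - (y - η • V.starProjection (G y))‖ := by
        rw [map_sub, smul_sub]; congr 1; abel
    _ ≤ _ := key
    _ = _ := by field_simp

/-- The tangential gradient step of a strongly convex and smooth function is a contraction on a
convex set with nonempty relative interior. -/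
theorem Convex.norm_gradient_step_sub_le (hK : Convex ℝ K)
    (hV : ∀ x ∈ K, ∀ y ∈ K, y - x ∈ V) {α : ℝ} (hα : 0 ≤ α) (hβ : 0 < β)
    (hf : ∀ x ∈ K, HasGradientAt f (G x) x)
    (hmono : ∀ x ∈ K, ∀ y ∈ K, α * ‖x - y‖ ^ 2 ≤ ⟪G x - G y, x - y⟫)
    (hlip : ∀ x ∈ K, ∀ y ∈ K, ‖G x - G y‖ ≤ β * ‖x - y‖) (hη : 0 ≤ η) (hηβ : η * β ≤ 2)
    {c : E} (hρ : 0 < ρ) (hroom : ∀ v ∈ V, ‖v‖ ≤ ρ → c + v ∈ K) {x y : E} (hx : x ∈ K)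
    (hy : y ∈ K) :
    ‖(x - y) - η • V.starProjection (G x - G y)‖ ≤
      Real.sqrt (1 - 2 * α * η + α * β * η ^ 2) * ‖x - y‖ := by
  have hc : c ∈ K := by simpa using hroom 0 V.zero_mem (by simpa using hρ.le)
  have hroom_t : ∀ z ∈ K, ∀ t ∈ Set.Ioc (0 : ℝ) 1, ∀ v ∈ V, ‖v‖ ≤ t * ρ →
      z + t • (c - z) + v ∈ K := by
    intro z hz t ht v hv hvt
    have h1 : c + t⁻¹ • v ∈ K := by
      refine hroom _ (V.smul_mem _ hv) ?_
      rw [norm_smul, norm_inv, Real.norm_of_nonneg ht.1.le, inv_mul_le_iff₀ ht.1]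
      exact hvt
    have h2 := hK.add_smul_sub_mem hz h1 (Set.Ioc_subset_Icc_self ht)
    convert h2 using 1
    rw [add_sub_right_comm, smul_add, smul_inv_smul₀ ht.1.ne', add_assoc]
  have hmem : ∀ z ∈ K, ∀ t ∈ Set.Ioc (0 : ℝ) 1, z + t • (c - z) ∈ K := fun z hz t ht =>
    hK.add_smul_sub_mem hz hc (Set.Ioc_subset_Icc_self ht)
  have hclose : ∀ z ∈ K, ∀ t ∈ Set.Ioc (0 : ℝ) 1,
      ‖(z - (z + t • (c - z))) - η • V.starProjection (G z - G (z + t • (c - z)))‖ ≤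
        t * ((1 + η * β) * ‖c - z‖) := by
    intro z hz t ht
    have h1 : ‖z - (z + t • (c - z))‖ = t * ‖c - z‖ := by
      rw [sub_add_cancel_left, norm_neg, norm_smul, Real.norm_of_nonneg ht.1.le]
    have h2 := (V.norm_starProjection_le _).trans (hlip z hz _ (hmem z hz t ht))
    refine (norm_sub_le _ _).trans ?_
    rw [norm_smul, Real.norm_of_nonneg hη]
    rw [h1] at h2 ⊢
    nlinarith [mul_le_mul_of_nonneg_left h2 hη]
  set A := ‖(x - y) - η • V.starProjection (G x - G y)‖
  set s := Real.sqrt (1 - 2 * α * η + α * β * η ^ 2)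
  set C := (1 + η * β) * ‖c - x‖ + (1 + η * β) * ‖c - y‖ with hC
  have hCnn : 0 ≤ C := by positivity
  have hbound : ∀ t ∈ Set.Ioc (0 : ℝ) 1, A ≤ s * ‖x - y‖ + t * C := by
    intro t ht
    have h1 := hK.norm_gradient_step_sub_le_of_interior hV hα hβ hf hmono hlip hη hηβ
      (mul_pos ht.1 hρ) (hroom_t x hx t ht) (hroom_t y hy t ht)
    have h2 : ‖x + t • (c - x) - (y + t • (c - y))‖ ≤ ‖x - y‖ := by
      have : x + t • (c - x) - (y + t • (c - y)) = (1 - t) • (x - y) := by module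
      rw [this, norm_smul, Real.norm_of_nonneg (by linarith [ht.2])]
      nlinarith [norm_nonneg (x - y), ht.1]
    have h3 := hclose x hx t ht
    have h4 := hclose y hy t ht
    set x' := x + t • (c - x)
    set y' := y + t • (c - y)
    have h5 : (x - y) - η • V.starProjection (G x - G y) =
        ((x - x') - η • V.starProjection (G x - G x')) +
        ((x' - y') - η • V.starProjection (G x' - G y')) -
        ((y - y') - η • V.starProjection (G y - G y')) := by
      simp only [map_sub, smul_sub]; abel
    have h6 : A ≤ _ := (congrArg norm h5).le.trans
      ((norm_sub_le _ _).trans (add_le_add_left (norm_add_le _ _) _))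
    have h7 : s * ‖x' - y'‖ ≤ s * ‖x - y‖ := by gcongr
    rw [hC, mul_add]
    linarith
  refine le_of_forall_pos_le_add fun ε hε => ?_
  have ht : min 1 (ε / (C + 1)) ∈ Set.Ioc (0 : ℝ) 1 :=
    ⟨lt_min one_pos (by positivity), min_le_left _ _⟩
  refine (hbound _ ht).trans ?_
  gcongr
  calc min 1 (ε / (C + 1)) * C ≤ ε / (C + 1) * (C + 1) := by
        gcongr
        · exact min_le_right _ _
        · linarith
    _ = ε := by field_simp

end FirstOrder

section Projection

variable {E : Type*} [NormedAddCommGroup E] [InnerProductSpace ℝ E] {K : Set E} {proj : E → E}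

theorem Convex.norm_sq_proj_sub_le (hK : Convex ℝ K)
    (hproj : ∀ x, proj x ∈ K ∧ ∀ y ∈ K, dist (proj x) x ≤ dist y x) (u v : E) :
    ‖proj u - proj v‖ ^ 2 ≤ ⟪u - v, proj u - proj v⟫ := by
  have hvar : ∀ u, ∀ w ∈ K, ⟪u - proj u, w - proj u⟫ ≤ 0 := by
    intro u
    have hne : Nonempty K := ⟨⟨_, (hproj u).1⟩⟩
    refine (norm_eq_iInf_iff_real_inner_le_zero hK (hproj u).1).1 (le_antisymm ?_ ?_)
    · refine le_ciInf fun w => ?_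
      have := (hproj u).2 w w.2
      rwa [dist_comm, dist_comm _ u, dist_eq_norm, dist_eq_norm] at this
    · exact ciInf_le ⟨0, by rintro _ ⟨w, rfl⟩; positivity⟩ (⟨_, (hproj u).1⟩ : K)
  have h1 := hvar u _ (hproj v).1
  have h2 := hvar v _ (hproj u).1
  have h3 : ⟪u - v, proj u - proj v⟫ - ‖proj u - proj v‖ ^ 2 =
      -(⟪u - proj u, proj v - proj u⟫ + ⟪v - proj v, proj u - proj v⟫) := by
    rw [← real_inner_self_eq_norm_sq]
    simp only [inner_sub_left, inner_sub_right]
    ring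
  linarith

theorem Convex.continuous_proj (hK : Convex ℝ K)
    (hproj : ∀ x, proj x ∈ K ∧ ∀ y ∈ K, dist (proj x) x ≤ dist y x) : Continuous proj := by
  refine LipschitzWith.continuous (K := 1) (LipschitzWith.of_dist_le_mul fun u v => ?_)
  rw [dist_eq_norm, dist_eq_norm, NNReal.coe_one, one_mul]
  have h1 := (hK.norm_sq_proj_sub_le hproj u v).trans (real_inner_le_norm _ _)
  rcases (norm_nonneg (proj u - proj v)).eq_or_lt with h | h
  · rw [← h]; positivity
  · rw [sq] at h1
    exact le_of_mul_le_mul_right h1 h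

end Projection

theorem Convex.exists_relative_ball {E : Type*} [NormedAddCommGroup E] [InnerProductSpace ℝ E]
    [FiniteDimensional ℝ E] {K : Set E} (hK : Convex ℝ K) (hne : K.Nonempty) :
    ∃ c : E, ∃ ρ > 0, ∀ v ∈ vectorSpan ℝ K, ‖v‖ ≤ ρ → c + v ∈ K := by
  obtain ⟨c, hc⟩ := hne.intrinsicInterior hK
  obtain ⟨c', hc', rfl⟩ := mem_intrinsicInterior.1 hc
  obtain ⟨r, hr, hball⟩ := Metric.isOpen_iff.1 isOpen_interior c' hc'
  refine ⟨c', r / 2, by positivity, fun v hv hvr => ?_⟩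
  have hmem : (c' : E) + v ∈ affineSpan ℝ K := by
    rw [add_comm]
    exact AffineSubspace.vadd_mem_of_mem_direction (by rwa [direction_affineSpan]) c'.2
  have : (⟨c' + v, hmem⟩ : affineSpan ℝ K) ∈ Metric.ball c' r := by
    rw [Metric.mem_ball, Subtype.dist_eq, dist_eq_norm, add_sub_cancel_left]
    linarith
  have h := interior_subset (hball this)
  exact h

/-- A projected gradient step of a strongly convex and smooth function is a contraction. -/
theorem Convex.norm_projected_gradient_step_sub_le {E : Type*} [NormedAddCommGroup E]
    [InnerProductSpace ℝ E] [FiniteDimensional ℝ E] {K : Set E} (hK : Convex ℝ K)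
    {f : E → ℝ} {G : E → E} {α β η : ℝ} (hα : 0 ≤ α) (hβ : 0 < β)
    (hf : ∀ x ∈ K, HasGradientAt f (G x) x)
    (hmono : ∀ x ∈ K, ∀ y ∈ K, α * ‖x - y‖ ^ 2 ≤ ⟪G x - G y, x - y⟫)
    (hlip : ∀ x ∈ K, ∀ y ∈ K, ‖G x - G y‖ ≤ β * ‖x - y‖) (hη : 0 ≤ η) (hηβ : η * β ≤ 2)
    {proj : E → E} (hproj : ∀ x, proj x ∈ K ∧ ∀ y ∈ K, dist (proj x) x ≤ dist y x)
    {x y : E} (hx : x ∈ K) (hy : y ∈ K) :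
    ‖proj (x - η • G x) - proj (y - η • G y)‖ ≤
      Real.sqrt (1 - 2 * α * η + α * β * η ^ 2) * ‖x - y‖ := by
  obtain ⟨c, ρ, hρ, hroom⟩ := hK.exists_relative_ball ⟨x, hx⟩
  set V := vectorSpan ℝ K
  have hV : ∀ x ∈ K, ∀ y ∈ K, y - x ∈ V := fun x hx y hy => vsub_mem_vectorSpan ℝ hy hx
  refine le_trans ?_
    (hK.norm_gradient_step_sub_le hV hα hβ hf hmono hlip hη hηβ hρ hroom hx hy)
  set p := proj (x - η • G x)
  set q := proj (y - η • G y)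
  have h1 := hK.norm_sq_proj_sub_le hproj (x - η • G x) (y - η • G y)
  have hpq : p - q ∈ V := hV _ (hproj _).1 _ (hproj _).1
  have h2 : x - η • G x - (y - η • G y) = (x - y) - η • (G x - G y) := by
    rw [smul_sub]; abel
  have h3 : V.starProjection (x - y) = x - y :=
    Submodule.starProjection_eq_self_iff.2 (hV y hy x hx)
  rw [h2, ← V.real_inner_starProjection_left hpq, map_sub, map_smul, h3] at h1
  have h4 := h1.trans (real_inner_le_norm _ _)
  rcases (norm_nonneg (p - q)).eq_or_lt with h | h
  · rw [← h]; positivity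
  · rw [sq] at h4
    exact le_of_mul_le_mul_right h4 h

section LocalDependence

variable {X Z : Type*} [MeasurableSpace Z] {D : Measure Z}
  [IsProbabilityMeasure D] {ℓ : X → Z → ℝ} {a b : ℝ}

open ProbabilityTheory in
theorem measure_pi_sum_risk_sub_ge_le {ι : Type*} [Fintype ι] {n : ℕ} (hn : 0 < n)
    (hcard : Fintype.card ι ≤ n) {θ : X} (hmeas : Measurable (ℓ θ)) (hb : 0 < b)
    (hrange : ∀ z, ℓ θ z ∈ Set.Icc a (a + b)) {ε : ℝ} (hε : 0 ≤ ε) :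
    (Measure.pi fun _ : ι => D) {S | ε ≤ ∑ i, (risk ℓ D θ - ℓ θ (S i))} ≤
      ENNReal.ofReal (Real.exp (-(2 * ε ^ 2 / (n * b ^ 2)))) := by
  set μ := Measure.pi fun _ : ι => D
  have hsub : ∀ i, HasSubgaussianMGF (fun S : ι → Z => risk ℓ D θ - ℓ θ (S i))
      ((‖b‖₊ / 2) ^ 2) μ := by
    intro i
    have h1 := hasSubgaussianMGF_of_mem_Icc (μ := μ) (X := fun S : ι → Z => -ℓ θ (S i))
      (a := -(a + b)) (b := -a) (hmeas.comp (measurable_pi_apply i)).neg.aemeasurable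
      (ae_of_all _ fun S => ⟨neg_le_neg (hrange _).2, neg_le_neg (hrange _).1⟩)
    have h2 : ∫ S : ι → Z, -ℓ θ (S i) ∂μ = -risk ℓ D θ := by
      rw [integral_neg, risk, ← integral_comp_eval (μ := fun _ : ι => D) (i := i)
        hmeas.aestronglyMeasurable]
    rw [h2] at h1
    have h3 : -a - -(a + b) = b := by ring
    rw [h3] at h1
    refine h1.congr (ae_of_all _ fun S => ?_)
    ring
  have hindep : iIndepFun (fun i (S : ι → Z) => risk ℓ D θ - ℓ θ (S i)) μ :=
    iIndepFun_pi (X := fun _ z => risk ℓ D θ - ℓ θ z) fun _ =>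
    (measurable_const.sub hmeas).aemeasurable
  have hsum := HasSubgaussianMGF.sum_of_iIndepFun hindep (s := Finset.univ) fun i _ => hsub i
  have hle : ((∑ _i : ι, (‖b‖₊ / 2) ^ 2 : NNReal) : ℝ) ≤ ((n * (‖b‖₊ / 2) ^ 2 : NNReal) : ℝ) := by
    rw [Finset.sum_const, nsmul_eq_mul, Finset.card_univ]
    gcongr
  have hsum' : HasSubgaussianMGF (fun S : ι → Z => ∑ i, (risk ℓ D θ - ℓ θ (S i)))
      (n * (‖b‖₊ / 2) ^ 2) μ :=
    ⟨hsum.integrable_exp_mul, fun t => (hsum.mgf_le t).trans (by gcongr)⟩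
  have key := hsum'.measure_ge_le hε
  rw [← ENNReal.ofReal_toReal (measure_ne_top μ _)]
  refine ENNReal.ofReal_le_ofReal (key.trans_eq ?_)
  congr 1
  push_cast
  rw [Real.norm_of_nonneg hb.le]
  field_simp

variable [MeasurableSpace X]

theorem measurable_risk (hℓ : Measurable (Function.uncurry ℓ)) : Measurable (risk ℓ D) :=
  (hℓ.stronglyMeasurable.integral_prod_right (ν := D)).measurable

/-- Conditionally on the sample points indexed by `J`, the other sample points satisfy a Hoeffding
bound for a parameter that depends only on `J`. -/
theorem measure_pi_sum_compl_risk_sub_ge_le {n : ℕ} (hn : 0 < n)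
    (hℓ : Measurable (Function.uncurry ℓ)) (hb : 0 < b)
    (hrange : ∀ θ z, ℓ θ z ∈ Set.Icc a (a + b)) (J : Finset (Fin n)) {ψ : (Fin n → Z) → X}
    (hψ : Measurable ψ) (hloc : ∀ S S', (∀ i ∈ J, S i = S' i) → ψ S = ψ S') {ε : ℝ} (hε : 0 ≤ ε) :
    (Measure.pi fun _ : Fin n => D)
        {S | ε ≤ ∑ i ∈ Jᶜ, (risk ℓ D (ψ S) - ℓ (ψ S) (S i))} ≤
      ENNReal.ofReal (Real.exp (-(2 * ε ^ 2 / (n * b ^ 2)))) := by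
  have hne : Nonempty Z := nonempty_of_isProbabilityMeasure D
  set A := {S : Fin n → Z | ε ≤ ∑ i ∈ Jᶜ, (risk ℓ D (ψ S) - ℓ (ψ S) (S i))} with hA
  have hAmeas : MeasurableSet A := by
    refine measurableSet_le measurable_const (Finset.measurable_fun_sum _ fun i _ => ?_)
    exact ((measurable_risk hℓ).comp hψ).sub (hℓ.comp (hψ.prodMk (measurable_pi_apply i)))
  have hmp := measurePreserving_piEquivPiSubtypeProd (fun _ : Fin n => D) (fun i => i ∈ J)
  set e := MeasurableEquiv.piEquivPiSubtypeProd (fun _ : Fin n => Z) (fun i => i ∈ J) with he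
  have heJ : ∀ u v, ∀ i (hi : i ∈ J), e.symm (u, v) i = u ⟨i, hi⟩ := fun u v i hi => by
    simp [he, MeasurableEquiv.piEquivPiSubtypeProd, Equiv.piEquivPiSubtypeProd, hi]
  have heJc : ∀ u v, ∀ i : {i // i ∉ J}, e.symm (u, v) i = v i := fun u v i => by
    simp [he, MeasurableEquiv.piEquivPiSubtypeProd, Equiv.piEquivPiSubtypeProd, i.2]
  rw [← (hmp.symm e).measure_preimage hAmeas.nullMeasurableSet,
    Measure.prod_apply (e.symm.measurable hAmeas)]
  refine (lintegral_mono
    (g := fun _ => ENNReal.ofReal (Real.exp (-(2 * ε ^ 2 / (n * b ^ 2))))) fun u => ?_).trans_eq ?_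
  · let v₀ : {i // i ∉ J} → Z := fun _ => Classical.arbitrary Z
    have hcard : Fintype.card {i // i ∉ J} ≤ n := by
      simp
    refine (measure_mono ?_).trans (measure_pi_sum_risk_sub_ge_le (D := D) hn hcard
      (θ := ψ (e.symm (u, v₀))) (hℓ.comp measurable_prodMk_left) hb (hrange _) hε)
    intro v hv
    have hψv : ψ (e.symm (u, v)) = ψ (e.symm (u, v₀)) :=
      hloc _ _ fun i hi => by rw [heJ u v i hi, heJ u v₀ i hi]
    simp only [hA, Set.mem_preimage, Set.mem_ofPred_eq] at hv ⊢
    rw [Finset.sum_subtype (p := fun i => i ∉ J) _ (fun i => by simp)] at hv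
    simpa only [hψv, heJc] using hv
  · simp

/-- A generalization bound for an algorithm `A` whose loss is uniformly close, up to a
data-independent offset, to that of an algorithm reading only the sample points indexed by `J`. -/
theorem generalization_bound_of_local_approx {n : ℕ} (hn : 0 < n)
    (hℓ : Measurable (Function.uncurry ℓ)) (hb : 0 < b)
    (hrange : ∀ θ z, ℓ θ z ∈ Set.Icc a (a + b)) (J : Finset (Fin n)) {A ψ : (Fin n → Z) → X}
    (hψ : Measurable ψ) (hloc : ∀ S S', (∀ i ∈ J, S i = S' i) → ψ S = ψ S')
    {h : X → ℝ} {κ : ℝ}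
    (hclose : ∀ S z, |ℓ (A S) z - h (A S) - (ℓ (ψ S) z - h (ψ S))| ≤ κ)
    {δ : ℝ} (hδ : δ ∈ Set.Ioc (0 : ℝ) 1) :
    (1 - δ : ℝ) ≤ ((Measure.pi fun _ : Fin n => D)
      {S | risk ℓ D (A S) - empRisk ℓ (A S) S ≤
        b * (J.card / n) + b * Real.sqrt (Real.log (2 / δ) / (2 * n)) + 2 * κ}).toReal := by
  have hn' : (0 : ℝ) < n := by exact_mod_cast hn
  have hlog : 0 < Real.log (2 / δ) :=
    Real.log_pos (by rw [lt_div_iff₀ hδ.1]; linarith [hδ.2])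
  set q := Real.log (2 / δ) with hq
  set ε := n * (b * Real.sqrt (q / (2 * n))) with hε
  have htail := measure_pi_sum_compl_risk_sub_ge_le (D := D) hn hℓ hb hrange J hψ hloc
    (ε := ε) (by positivity)
  have hexp : Real.exp (-(2 * ε ^ 2 / (n * b ^ 2))) ≤ δ := by
    have : 2 * ε ^ 2 / (n * b ^ 2) = q := by
      rw [hε, mul_pow, mul_pow, Real.sq_sqrt (by positivity)]
      field_simp
    rw [this, hq, Real.exp_neg, Real.exp_log (div_pos two_pos hδ.1), inv_div]
    linarith [hδ.1]
  set μ := Measure.pi fun _ : Fin n => D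
  set bad := {S : Fin n → Z | ε ≤ ∑ i ∈ Jᶜ, (risk ℓ D (ψ S) - ℓ (ψ S) (S i))}
  set good := {S : Fin n → Z | risk ℓ D (A S) - empRisk ℓ (A S) S ≤
    b * (J.card / n) + b * Real.sqrt (q / (2 * n)) + 2 * κ}
  have hint : ∀ θ, Integrable (ℓ θ) D := fun θ =>
    Integrable.of_mem_Icc a (a + b) (hℓ.comp measurable_prodMk_left).aemeasurable
      (ae_of_all _ (hrange θ))
  have hrisk : ∀ θ, risk ℓ D θ ≤ a + b := fun θ => by
    calc risk ℓ D θ ≤ ∫ _, a + b ∂D :=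
          integral_mono (hint θ) (integrable_const _) fun z => (hrange θ z).2
      _ = a + b := by simp
  have hcover : Set.univ ⊆ bad ∪ good := by
    intro S _
    rw [Set.mem_union, or_iff_not_imp_left]
    intro hS
    simp only [bad, Set.mem_ofPred_eq, not_le] at hS
    have h1 : risk ℓ D (A S) - risk ℓ D (ψ S) ≤ h (A S) - h (ψ S) + κ := by
      rw [risk, risk, ← integral_sub (hint _) (hint _)]
      calc _ ≤ ∫ _, h (A S) - h (ψ S) + κ ∂D :=
            integral_mono ((hint _).sub (hint _)) (integrable_const _) fun z => by
              have := (abs_le.1 (hclose S z)).2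
              rw [Pi.sub_apply]
              linarith
        _ = _ := by simp
    have h2 : (n : ℝ) * (h (A S) - h (ψ S) - κ) ≤ ∑ i, ℓ (A S) (S i) - ∑ i, ℓ (ψ S) (S i) := by
      rw [← Finset.sum_sub_distrib]
      have := Finset.card_nsmul_le_sum Finset.univ
        (fun i => ℓ (A S) (S i) - ℓ (ψ S) (S i)) (h (A S) - h (ψ S) - κ) fun i _ => by
          have := (abs_le.1 (hclose S (S i))).1
          linarith
      simpa using this
    have h3 : ∑ i ∈ J, (risk ℓ D (ψ S) - ℓ (ψ S) (S i)) ≤ J.card * b := by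
      have := Finset.sum_le_card_nsmul J (fun i => risk ℓ D (ψ S) - ℓ (ψ S) (S i)) b fun i _ => by
        linarith [hrisk (ψ S), (hrange (ψ S) (S i)).1]
      simpa using this
    have h4 : n * risk ℓ D (ψ S) - ∑ i, ℓ (ψ S) (S i) < J.card * b + ε := by
      calc _ = ∑ i, (risk ℓ D (ψ S) - ℓ (ψ S) (S i)) := by simp
        _ < _ := by rw [← Finset.sum_add_sum_compl J]; linarith
    have h5 : n * (risk ℓ D (A S) - empRisk ℓ (A S) S) ≤
        n * (b * (J.card / n) + b * Real.sqrt (q / (2 * n)) + 2 * κ) := by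
      have e1 : n * (risk ℓ D (A S) - empRisk ℓ (A S) S) =
          n * risk ℓ D (A S) - ∑ i, ℓ (A S) (S i) := by
        rw [empRisk]; field_simp
      have e2 : n * (b * (J.card / n) + b * Real.sqrt (q / (2 * n)) + 2 * κ) =
          J.card * b + ε + 2 * (n * κ) := by
        rw [hε]; field_simp
      have h6 := mul_le_mul_of_nonneg_left h1 hn'.le
      rw [e1, e2]
      linarith
    exact le_of_mul_le_mul_left h5 hn'
  have h1 : (1 : ENNReal) ≤ ENNReal.ofReal δ + μ good := by
    calc (1 : ENNReal) = μ Set.univ := measure_univ.symm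
      _ ≤ μ bad + μ good := (measure_mono hcover).trans (measure_union_le _ _)
      _ ≤ _ := by
        gcongr
        exact htail.trans (ENNReal.ofReal_le_ofReal hexp)
  have h2 := ENNReal.toReal_mono (by finiteness) h1
  rw [ENNReal.toReal_add ENNReal.ofReal_ne_top (measure_ne_top _ _),
    ENNReal.toReal_ofReal hδ.1.le, ENNReal.toReal_one] at h2
  linarith

end LocalDependence

section Iterates

variable {k : ℕ} {Z : Type*} {ℓ : EuclideanSpace ℝ (Fin k) → Z → ℝ}
  {proj : EuclideanSpace ℝ (Fin k) → EuclideanSpace ℝ (Fin k)} {η : ℝ} {n : ℕ}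
  {Θset : Set (EuclideanSpace ℝ (Fin k))}

theorem sgdIter_mem (hproj : ∀ x, proj x ∈ Θset) {x : EuclideanSpace ℝ (Fin k)} (hx : x ∈ Θset)
    (S : Fin n → Z) (idx : ℕ → Fin n) : ∀ t, sgdIter proj ℓ η S idx x t ∈ Θset
  | 0 => hx
  | _ + 1 => hproj _

theorem sgdIter_add (S : Fin n → Z) (idx : ℕ → Fin n) (x : EuclideanSpace ℝ (Fin k)) (s : ℕ) :
    ∀ m, sgdIter proj ℓ η S idx x (s + m) =
      sgdIter proj ℓ η S (fun t => idx (s + t)) (sgdIter proj ℓ η S idx x s) m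
  | 0 => rfl
  | m + 1 => by
    rw [← add_assoc, sgdIter, sgdIter, sgdIter_add S idx x s m]

theorem sgdIter_congr {S S' : Fin n → Z} {idx : ℕ → Fin n} (x : EuclideanSpace ℝ (Fin k)) :
    ∀ {m : ℕ}, (∀ t < m, S (idx t) = S' (idx t)) →
      sgdIter proj ℓ η S idx x m = sgdIter proj ℓ η S' idx x m
  | 0, _ => rfl
  | m + 1, hS => by
    rw [sgdIter, sgdIter, sgdIter_congr x fun t ht => hS t (ht.trans m.lt_succ_self),
      hS m m.lt_succ_self]

theorem norm_sgdIter_sub_le (hproj : ∀ x, proj x ∈ Θset) {γ : ℝ} (hγ : 0 ≤ γ)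
    (hcontr : ∀ z, ∀ x ∈ Θset, ∀ y ∈ Θset,
      ‖proj (x - η • gradient (fun θ => ℓ θ z) x) - proj (y - η • gradient (fun θ => ℓ θ z) y)‖ ≤
        γ * ‖x - y‖)
    (S : Fin n → Z) (idx : ℕ → Fin n) {x y : EuclideanSpace ℝ (Fin k)} (hx : x ∈ Θset)
    (hy : y ∈ Θset) : ∀ m,
      ‖sgdIter proj ℓ η S idx x m - sgdIter proj ℓ η S idx y m‖ ≤ γ ^ m * ‖x - y‖
  | 0 => by simp [sgdIter]
  | m + 1 => by
    rw [sgdIter, sgdIter, pow_succ', mul_assoc]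
    exact (hcontr _ _ (sgdIter_mem hproj hx S idx m) _ (sgdIter_mem hproj hy S idx m)).trans
      (mul_le_mul_of_nonneg_left (norm_sgdIter_sub_le hproj hγ hcontr S idx hx hy m) hγ)

open Filter Topology in
theorem measurable_gradient_comp [MeasurableSpace Z] (hℓ : Measurable (Function.uncurry ℓ))
    {Ω : Type*} [MeasurableSpace Ω] {θ : Ω → EuclideanSpace ℝ (Fin k)} {z : Ω → Z}
    (hθ : Measurable θ) (hz : Measurable z)
    (hdiff : ∀ ω, DifferentiableAt ℝ (fun θ' => ℓ θ' (z ω)) (θ ω)) :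
    Measurable fun ω => gradient (fun θ' => ℓ θ' (z ω)) (θ ω) := by
  have hinner : ∀ v, Measurable fun ω => ⟪v, gradient (fun θ' => ℓ θ' (z ω)) (θ ω)⟫ := by
    intro v
    refine measurable_of_tendsto_metrizable
      (f := fun (j : ℕ) ω => (j : ℝ) • (ℓ (θ ω + (j : ℝ)⁻¹ • v) (z ω) - ℓ (θ ω) (z ω))) ?_ ?_
    · intro j
      have h1 := hℓ.comp ((hθ.add_const ((j : ℝ)⁻¹ • v)).prodMk hz)
      exact (h1.sub (hℓ.comp (hθ.prodMk hz))).const_smul (j : ℝ)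
    · rw [tendsto_pi_nhds]
      intro ω
      have h1 := hasGradientAt_iff_hasFDerivAt.1 (hdiff ω).hasGradientAt
      have h2 := (h1.lim_real v).comp tendsto_natCast_atTop_atTop
      rwa [InnerProductSpace.toDual_apply_apply, real_inner_comm] at h2
  have hsum : (fun ω => gradient (fun θ' => ℓ θ' (z ω)) (θ ω)) = fun ω =>
      ∑ i, ⟪EuclideanSpace.basisFun (Fin k) ℝ i, gradient (fun θ' => ℓ θ' (z ω)) (θ ω)⟫ •
        EuclideanSpace.basisFun (Fin k) ℝ i := by
    ext1 ω
    exact ((EuclideanSpace.basisFun (Fin k) ℝ).sum_repr' _).symm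
  rw [hsum]
  exact Finset.measurable_fun_sum _ fun i _ => (hinner _).smul_const _

theorem measurable_sgdIter [MeasurableSpace Z] (hℓ : Measurable (Function.uncurry ℓ))
    (hproj : ∀ x, proj x ∈ Θset) (hproj_cont : Continuous proj)
    (hdiff : ∀ z, ∀ θ ∈ Θset, DifferentiableAt ℝ (fun θ' => ℓ θ' z) θ)
    {x : EuclideanSpace ℝ (Fin k)} (hx : x ∈ Θset) (idx : ℕ → Fin n) :
    ∀ m, Measurable fun S : Fin n → Z => sgdIter proj ℓ η S idx x m
  | 0 => measurable_const
  | m + 1 => by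
    have ih := measurable_sgdIter hℓ hproj hproj_cont hdiff hx idx m
    have hgrad := measurable_gradient_comp hℓ ih (measurable_pi_apply (idx m))
      fun S => hdiff _ _ (sgdIter_mem hproj hx S idx m)
    exact hproj_cont.measurable.comp (ih.sub (hgrad.const_smul η))

end Iterates

theorem exists_contraction_steps {n T : ℕ} (hn : 0 < n) (hT : 1 ≤ T) {R γ q : ℝ} (hR : 0 < R)
    (hγ0 : 0 ≤ γ) (hγ1 : γ < 1) (hq : Real.log 2 ≤ q) :
    ∃ m ≤ T, (m = T ∨ γ ^ m * R ≤ 1 / n) ∧ ∀ c : ℕ, c ≤ m → c ≤ n →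
      (c : ℝ) / n + Real.sqrt (q / (2 * n)) ≤
        4 * Real.sqrt (max ((⌈Real.log (2 * R * n) / Real.log (1 / γ)⌉ : ℝ) * Real.log 2) 0 / n) +
          Real.sqrt (8 * q / n) := by
  have hn' : (0 : ℝ) < n := by exact_mod_cast hn
  have hlog2 : 0.69 < Real.log 2 := by linarith [Real.log_two_gt_d9]
  have hq0 : 0 < q := by linarith
  rcases hγ0.eq_or_lt with rfl | hγ0
  · refine ⟨1, hT, Or.inr ?_, fun c hc _ => ?_⟩
    · simp
    have hc' : (c : ℝ) ≤ 1 := by exact_mod_cast hc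
    have h1 : (c : ℝ) / n ≤ Real.sqrt (1 / n) := by
      have h2 : (1 : ℝ) / n ≤ 1 := by
        rw [div_le_one hn']; exact_mod_cast hn
      calc (c : ℝ) / n ≤ 1 / n := by gcongr
        _ ≤ _ := Real.le_sqrt_of_sq_le (by nlinarith [one_div_pos.2 hn'])
    have h3 : Real.sqrt (1 / n) + Real.sqrt (q / (2 * n)) ≤ Real.sqrt (8 * q / n) := by
      have e1 : Real.sqrt (1 / n) ≤ 3 / 2 * Real.sqrt (q / n) := by
        rw [show (3 / 2 : ℝ) = Real.sqrt ((3 / 2) ^ 2) by rw [Real.sqrt_sq]; norm_num,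
          ← Real.sqrt_mul (by norm_num), ← mul_div_assoc]
        apply Real.sqrt_le_sqrt
        gcongr
        linarith
      have e2 : Real.sqrt (q / (2 * n)) ≤ 1 * Real.sqrt (q / n) := by
        rw [one_mul]
        apply Real.sqrt_le_sqrt
        gcongr
        linarith
      have e3 : 5 / 2 * Real.sqrt (q / n) ≤ Real.sqrt (8 * q / n) := by
        rw [show (5 / 2 : ℝ) = Real.sqrt ((5 / 2) ^ 2) by rw [Real.sqrt_sq]; norm_num,
          ← Real.sqrt_mul (by norm_num), ← mul_div_assoc]
        apply Real.sqrt_le_sqrt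
        gcongr
        norm_num
      linarith
    have h4 : 0 ≤ 4 * Real.sqrt
        (max ((⌈Real.log (2 * R * n) / Real.log (1 / 0)⌉ : ℝ) * Real.log 2) 0 / n) := by
      positivity
    linarith
  · set N := ⌈Real.log (2 * R * n) / Real.log (1 / γ)⌉ with hN
    refine ⟨min N.toNat T, min_le_right _ _, ?_, fun c hc hcn => ?_⟩
    · rcases le_total T N.toNat with h | h
      · exact Or.inl (min_eq_right h)
      right
      rw [min_eq_left h]
      have hlogγ : 0 < Real.log (1 / γ) := Real.log_pos (by rwa [lt_div_iff₀ hγ0, one_mul])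
      have h1 : Real.log (2 * R * n) / Real.log (1 / γ) ≤ (N.toNat : ℝ) :=
        (Int.le_ceil _).trans (by exact_mod_cast Int.self_le_toNat N)
      rw [div_le_iff₀ hlogγ, ← Real.log_pow, Real.log_le_log_iff (by positivity) (by positivity),
        one_div, inv_pow, le_inv_comm₀ (by positivity) (by positivity)] at h1
      calc γ ^ N.toNat * R ≤ (2 * R * n)⁻¹ * R := by gcongr
        _ = 1 / (2 * n) := by field_simp
        _ ≤ 1 / n := by gcongr; linarith
    · have hcn' : (c : ℝ) / n ≤ 1 := by
        rw [div_le_one hn']; exact_mod_cast hcn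
      have hcN : (c : ℝ) ≤ 16 * max ((N : ℝ) * Real.log 2) 0 := by
        rcases le_total N 0 with h | h
        · have : c = 0 := by
            have := hc.trans (min_le_left _ _)
            rw [Int.toNat_of_nonpos h] at this
            omega
          simp [this]
        · have h1 : (c : ℤ) ≤ N := by
            have := hc.trans (min_le_left _ _)
            omega
          have h2 : (c : ℝ) ≤ N := by exact_mod_cast h1
          have h3 : (0 : ℝ) ≤ N := by exact_mod_cast h
          nlinarith [le_max_left ((N : ℝ) * Real.log 2) 0]
      have h1 : (c : ℝ) / n ≤ 4 * Real.sqrt (max ((N : ℝ) * Real.log 2) 0 / n) := by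
        rw [show (4 : ℝ) = Real.sqrt 16 by
          rw [show (16 : ℝ) = 4 ^ 2 by norm_num, Real.sqrt_sq]; norm_num,
          ← Real.sqrt_mul (by norm_num), ← mul_div_assoc]
        refine Real.le_sqrt_of_sq_le ?_
        calc ((c : ℝ) / n) ^ 2 ≤ c / n := by
              have : (0 : ℝ) ≤ c / n := by positivity
              nlinarith
          _ ≤ _ := by gcongr
      have h2 : Real.sqrt (q / (2 * n)) ≤ Real.sqrt (8 * q / n) := by
        apply Real.sqrt_le_sqrt
        gcongr <;> linarith
      linarith

/-- dimension-independent generalization bound for projected SGD.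
For an `[a,a+b]`-valued, `α`-strongly convex, `β`-smooth, `L`-weakly-Lipschitz loss on a
compact convex `Θ ⊂ ℝᵏ` of diameter at most `R`, projected SGD with step size
`η ∈ (0, 2/β)`, any initialization `θ₁ ∈ Θ` and any fixed indices `i₁,…,i_T` satisfies, with
probability at least `1 − δ` over `Sⁿ ~ Dⁿ`,
`R(θ̂) − R̂(θ̂, Sⁿ) ≤ 4b √(max{⌈ln(2Rn)/ln(1/γ)⌉ ln 2, 0}/n) + b √(8 ln(2/δ)/n) + 2L/n`
with `γ = √(1 − 2αη + αβη²)`. -/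
theorem stmt_8 {k : ℕ} {Z : Type*} [MeasurableSpace Z]
    (D : Measure Z) [IsProbabilityMeasure D] (n : ℕ) (hn : 0 < n)
    (ℓ : EuclideanSpace ℝ (Fin k) → Z → ℝ) (hℓmeas : Measurable (Function.uncurry ℓ))
    (Θset : Set (EuclideanSpace ℝ (Fin k))) (hΘcompact : IsCompact Θset)
    (hΘconvex : Convex ℝ Θset) (R : ℝ) (hR : 0 < R) (hΘdiam : Metric.diam Θset ≤ R)
    (a b α β L : ℝ) (hb : 0 < b) (hα : 0 < α) (hβ : 0 < β) (hLpos : 0 < L)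
    (hrange : ∀ θ z, ℓ θ z ∈ Set.Icc a (a + b))
    (hdiff : ∀ z, ∀ θ ∈ Θset, DifferentiableAt ℝ (fun θ' => ℓ θ' z) θ)
    (hsc : ∀ z, ∀ θ ∈ Θset, ∀ θ' ∈ Θset,
      α * ‖θ - θ'‖ ^ 2 ≤
        ⟪gradient (fun ϑ => ℓ ϑ z) θ - gradient (fun ϑ => ℓ ϑ z) θ', θ - θ'⟫)
    (hsmooth : ∀ z, ∀ θ ∈ Θset, ∀ θ' ∈ Θset,
      ‖gradient (fun ϑ => ℓ ϑ z) θ - gradient (fun ϑ => ℓ ϑ z) θ'‖ ≤ β * ‖θ - θ'‖)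
    (h : EuclideanSpace ℝ (Fin k) → ℝ)
    (hweakLip : ∀ z, ∀ θ ∈ Θset, ∀ θ' ∈ Θset,
      |ℓ θ z - h θ - (ℓ θ' z - h θ')| ≤ L * ‖θ - θ'‖)
    (proj : EuclideanSpace ℝ (Fin k) → EuclideanSpace ℝ (Fin k))
    (hproj : ∀ x, proj x ∈ Θset ∧ ∀ y ∈ Θset, dist (proj x) x ≤ dist y x)
    (θ₁ : EuclideanSpace ℝ (Fin k)) (hθ₁ : θ₁ ∈ Θset)
    (η : ℝ) (hη : η ∈ Set.Ioo 0 (2 / β))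
    (T : ℕ) (hT : 1 ≤ T) (idx : ℕ → Fin n)
    (δ : ℝ) (hδ : δ ∈ Set.Ioc (0 : ℝ) 1)
    (γ : ℝ) (hγ : γ = Real.sqrt (1 - 2 * α * η + α * β * η ^ 2)) :
    (1 - δ : ℝ) ≤
      ((Measure.pi fun _ : Fin n => D)
        {S | risk ℓ D (sgdIter proj ℓ η S idx θ₁ T) -
              empRisk ℓ (sgdIter proj ℓ η S idx θ₁ T) S ≤
            4 * b * Real.sqrt
              (max ((⌈Real.log (2 * R * n) / Real.log (1 / γ)⌉ : ℝ) * Real.log 2) 0 / n) +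
            b * Real.sqrt (8 * Real.log (2 / δ) / n) + 2 * L / n}).toReal := by
  have hproj_mem : ∀ x, proj x ∈ Θset := fun x => (hproj x).1
  have hη0 : 0 < η := hη.1
  have hηβ : η * β < 2 := by rw [← lt_div_iff₀ hβ]; exact hη.2
  have hn' : (0 : ℝ) < n := by exact_mod_cast hn
  have hγ0 : 0 ≤ γ := hγ ▸ Real.sqrt_nonneg _
  have hγ1 : γ < 1 := by
    rw [hγ, Real.sqrt_lt' one_pos]
    nlinarith [mul_pos (mul_pos hα hη0) (sub_pos.2 hηβ)]
  have hcontr : ∀ z, ∀ x ∈ Θset, ∀ y ∈ Θset,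
      ‖proj (x - η • gradient (fun θ => ℓ θ z) x) - proj (y - η • gradient (fun θ => ℓ θ z) y)‖ ≤
        γ * ‖x - y‖ := fun z x hx y hy => by
    rw [hγ]
    exact hΘconvex.norm_projected_gradient_step_sub_le hα.le hβ
      (fun θ hθ => (hdiff z θ hθ).hasGradientAt) (hsc z) (hsmooth z) hη0.le hηβ.le hproj hx hy
  have hq : Real.log 2 ≤ Real.log (2 / δ) :=
    Real.log_le_log two_pos (by rw [le_div_iff₀ hδ.1]; linarith [hδ.2])
  obtain ⟨m, hmT, hm, hbound⟩ := exists_contraction_steps hn hT hR hγ0 hγ1 hq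
  set idx' : ℕ → Fin n := fun t => idx (T - m + t)
  set J : Finset (Fin n) := (Finset.range m).image idx'
  have hJm : J.card ≤ m := Finset.card_image_le.trans_eq (Finset.card_range m)
  have hJn : J.card ≤ n := by simpa using Finset.card_le_univ J
  have hsplit : ∀ S, sgdIter proj ℓ η S idx θ₁ T =
      sgdIter proj ℓ η S idx' (sgdIter proj ℓ η S idx θ₁ (T - m)) m := fun S => by
    rw [← sgdIter_add, Nat.sub_add_cancel hmT]
  have hnorm : ∀ S, ‖sgdIter proj ℓ η S idx θ₁ T - sgdIter proj ℓ η S idx' θ₁ m‖ ≤ 1 / n := by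
    intro S
    have hmem := sgdIter_mem (ℓ := ℓ) (η := η) hproj_mem hθ₁ S idx (T - m)
    rw [hsplit]
    rcases hm with rfl | hm
    · simp [sgdIter]
    · refine (norm_sgdIter_sub_le hproj_mem hγ0 hcontr S idx' hmem hθ₁ m).trans
        (le_trans ?_ hm)
      gcongr
      rw [← dist_eq_norm]
      exact (Metric.dist_le_diam_of_mem hΘcompact.isBounded hmem hθ₁).trans hΘdiam
  have key := generalization_bound_of_local_approx (D := D) hn hℓmeas hb hrange J
    (A := fun S => sgdIter proj ℓ η S idx θ₁ T) (ψ := fun S => sgdIter proj ℓ η S idx' θ₁ m)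
    (measurable_sgdIter hℓmeas hproj_mem (hΘconvex.continuous_proj hproj) hdiff hθ₁ idx' m)
    (fun S S' hS => sgdIter_congr θ₁ fun t ht =>
      hS _ (Finset.mem_image_of_mem _ (Finset.mem_range.2 ht)))
    (h := h) (κ := L * (1 / n))
    (fun S z => (hweakLip z _ (sgdIter_mem hproj_mem hθ₁ S idx T) _
      (sgdIter_mem hproj_mem hθ₁ S idx' m)).trans (by gcongr; exact hnorm S)) hδ
  refine key.trans (ENNReal.toReal_mono (measure_ne_top _ _) (measure_mono fun S hS => ?_))
  rw [Set.mem_ofPred_eq] at hS ⊢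
  refine hS.trans ?_
  have h1 := mul_le_mul_of_nonneg_left (hbound J.card hJm hJn) hb.le
  have h2 : 2 * (L * (1 / n)) = 2 * L / n := by ring
  rw [h2]
  linarith
end

section
/- ARC bound for compression schemes: Suppose the algorithm A : Z^n → Θ is a k-compression scheme, i.e., A(S^n) = A₂(A₁(S^n)) where A₁ maps any size-n sample to a size-k subsample of it (k ≤ n) and A₂ : Z^k → Θ is deterministic, and losses take values in [0,1]. Then for any pair of size-n samples S⁻, S⁺, Rad(Θ̂ⁿ, S⁺) ≤ √( k·log(2en/k) / (2n) ), where Θ̂ⁿ = {A(S_σ) : σ ∈ {−1,+1}ⁿ}. -/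
open MeasureTheory Real

/-- The moment generating function of a Rademacher sum. -/
lemma sum_exp_rademacher {n : ℕ} (b : Fin n → ℝ) :
    ∑ σ : Fin n → Bool, exp (∑ i, (if σ i then (1 : ℝ) else -1) * b i) =
      2 ^ n * ∏ i, cosh (b i) := by
  have h : ∀ i, 2 * cosh (b i) = ∑ s : Bool, exp ((if s then (1 : ℝ) else -1) * b i) := by
    intro i
    simp [cosh_eq]
    ring
  have h2 : (2 : ℝ) ^ n * ∏ i, cosh (b i) = ∏ i, (2 * cosh (b i)) := by
    simp [Finset.prod_mul_distrib]
  rw [h2, Finset.prod_congr rfl fun i _ => h i, Finset.prod_univ_sum, Fintype.piFinset_univ]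
  exact Finset.sum_congr rfl fun σ _ => exp_sum _ _

lemma sum_exp_rademacher_le {n : ℕ} (b : Fin n → ℝ) (c : ℝ) (hb : ∀ i, b i ^ 2 ≤ c) :
    ∑ σ : Fin n → Bool, exp (∑ i, (if σ i then (1 : ℝ) else -1) * b i) ≤
      2 ^ n * exp (n * c / 2) := by
  rw [sum_exp_rademacher]
  gcongr
  calc ∏ i, cosh (b i) ≤ ∏ _i : Fin n, exp (c / 2) := by
        refine Finset.prod_le_prod (fun i _ => (cosh_pos _).le) fun i _ => ?_
        refine (cosh_le_exp_half_sq _).trans (exp_le_exp.2 ?_)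
        linarith [hb i]
    _ = exp (n * c / 2) := by
        rw [Finset.prod_const, Finset.card_univ, Fintype.card_fin, ← exp_nat_mul]
        ring_nf

lemma sum_rademacher_eq_zero (n : ℕ) :
    ∑ σ : Fin n → Bool, ∑ i, (if σ i then (1 : ℝ) else -1) = 0 := by
  have h : ∑ σ : Fin n → Bool, ∑ i, (if σ i then (1 : ℝ) else -1) =
      ∑ σ : Fin n → Bool, -∑ i, (if σ i then (1 : ℝ) else -1) := by
    refine Fintype.sum_equiv (Equiv.arrowCongr (Equiv.refl _) Equiv.boolNot) _ _ fun σ => ?_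
    rw [← Finset.sum_neg_distrib]
    refine Finset.sum_congr rfl fun i _ => ?_
    cases h : σ i <;> simp [h]
  rw [Finset.sum_neg_distrib] at h
  linarith

/-- Massart's finite class lemma for vectors with entries in `[0,1]`, in unnormalised form. -/
lemma massart_unitInterval {J : Type*} [Fintype J] {n : ℕ} (v : J → Fin n → ℝ)
    (hv : ∀ j i, v j i ∈ Set.Icc (0 : ℝ) 1) (M : (Fin n → Bool) → ℝ)
    (hM : ∀ σ, ∃ j, M σ ≤ ∑ i, (if σ i then (1 : ℝ) else -1) * v j i)
    {s : ℝ} (hs : 0 < s) (hJ : (Fintype.card J : ℝ) ≤ exp (2 * n * s ^ 2)) :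
    ∑ σ, M σ ≤ 2 ^ n * (n * s) := by
  have hpt : ∀ σ, 4 * s * (M σ - 1 / 2 * ∑ i, (if σ i then (1 : ℝ) else -1)) ≤
      (∑ j, exp (∑ i, (if σ i then (1 : ℝ) else -1) * (4 * s * (v j i - 1 / 2)))) *
        exp (-(4 * n * s ^ 2)) + (4 * n * s ^ 2 - 1) := by
    intro σ
    obtain ⟨j, hj⟩ := hM σ
    set x := ∑ i, (if σ i then (1 : ℝ) else -1) * (4 * s * (v j i - 1 / 2)) with hx
    have hxe : x = 4 * s * (∑ i, (if σ i then (1 : ℝ) else -1) * v j i -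
        1 / 2 * ∑ i, (if σ i then (1 : ℝ) else -1)) := by
      rw [hx, Finset.mul_sum, ← Finset.sum_sub_distrib, Finset.mul_sum]
      exact Finset.sum_congr rfl fun i _ => by ring
    have h1 : 4 * s * (M σ - 1 / 2 * ∑ i, (if σ i then (1 : ℝ) else -1)) ≤ x := by
      rw [hxe]
      gcongr
    have h2 : exp x ≤
        ∑ j, exp (∑ i, (if σ i then (1 : ℝ) else -1) * (4 * s * (v j i - 1 / 2))) :=
      Finset.single_le_sum
        (f := fun j => exp (∑ i, (if σ i then (1 : ℝ) else -1) * (4 * s * (v j i - 1 / 2))))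
        (fun _ _ => (exp_pos _).le) (Finset.mem_univ j)
    have h3 := mul_le_mul_of_nonneg_right h2 (exp_pos (-(4 * n * s ^ 2))).le
    rw [← exp_add] at h3
    have h4 := add_one_le_exp (x + -(4 * n * s ^ 2))
    linarith
  have hmgf : ∑ σ : Fin n → Bool,
      ∑ j, exp (∑ i, (if σ i then (1 : ℝ) else -1) * (4 * s * (v j i - 1 / 2))) ≤
      2 ^ n * exp (4 * n * s ^ 2) := by
    rw [Finset.sum_comm]
    calc _ ≤ ∑ _j : J, (2 : ℝ) ^ n * exp (n * (4 * s ^ 2) / 2) := by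
          refine Finset.sum_le_sum fun j _ => sum_exp_rademacher_le _ _ fun i => ?_
          obtain ⟨h0, h1⟩ := hv j i
          have : (v j i - 1 / 2) ^ 2 ≤ 1 / 4 := by nlinarith
          nlinarith [sq_nonneg s]
      _ = Fintype.card J * ((2 : ℝ) ^ n * exp (2 * n * s ^ 2)) := by
          rw [Finset.sum_const, Finset.card_univ, nsmul_eq_mul]
          ring_nf
      _ ≤ exp (2 * n * s ^ 2) * ((2 : ℝ) ^ n * exp (2 * n * s ^ 2)) := by gcongr
      _ = 2 ^ n * exp (4 * n * s ^ 2) := by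
          rw [mul_left_comm, ← exp_add]
          ring_nf
  have hsum := Finset.sum_le_sum fun σ (_ : σ ∈ Finset.univ) => hpt σ
  rw [← Finset.mul_sum, Finset.sum_sub_distrib, ← Finset.mul_sum, sum_rademacher_eq_zero,
    Finset.sum_add_distrib, ← Finset.sum_mul, Finset.sum_const, Finset.card_univ,
    Fintype.card_fun, Fintype.card_bool, Fintype.card_fin, nsmul_eq_mul] at hsum
  have h5 := mul_le_mul_of_nonneg_right hmgf (exp_pos (-(4 * n * s ^ 2))).le
  rw [mul_assoc (2 ^ n : ℝ), ← exp_add, add_neg_cancel, exp_zero] at h5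
  push_cast at hsum
  have h6 : 4 * s * ∑ σ, M σ ≤ 4 * s * (2 ^ n * (n * s)) := by linarith
  exact le_of_mul_le_mul_left h6 (by positivity)

lemma choose_le_exp_one_mul_div_pow (n : ℕ) {k : ℕ} (hk : 0 < k) :
    (n.choose k : ℝ) ≤ (exp 1 * n / k) ^ k := by
  have hk' : (0 : ℝ) < k := by exact_mod_cast hk
  have hkf : (0 : ℝ) < k.factorial := by exact_mod_cast k.factorial_pos
  have h1 : (n.choose k : ℝ) ≤ (n : ℝ) ^ k / k.factorial := Nat.choose_le_pow_div k n
  have h2 : (k : ℝ) ^ k / k.factorial ≤ exp k := pow_div_factorial_le_exp _ hk'.le k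
  have h3 : (exp 1 * n / k) ^ k = exp k * ((n : ℝ) ^ k / k ^ k) := by
    rw [div_pow, mul_pow, ← exp_nat_mul, mul_one, mul_div_assoc]
  rw [h3]
  calc (n.choose k : ℝ) ≤ (n : ℝ) ^ k / k.factorial := h1
    _ = (k : ℝ) ^ k / k.factorial * ((n : ℝ) ^ k / k ^ k) := by field_simp
    _ ≤ _ := by gcongr

/-- ARC bound for compression schemes.
If `A = A₂ ∘ A₁` is a `k`-compression scheme (`A₁` selects a size-`k` subsample, `A₂` is
deterministic) and losses take values in `[0,1]`, then for any pair of size-`n` samples,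
`Rad(Θ̂ⁿ, S⁺) ≤ √(k log(2en/k)/(2n))`. -/
theorem stmt_10 {Θ Z : Type*} (n k : ℕ) (hk : 0 < k) (hkn : k ≤ n)
    (ℓ : Θ → Z → ℝ) (hrange : ∀ θ z, ℓ θ z ∈ Set.Icc (0 : ℝ) 1)
    (A : (Fin n → Z) → Θ) (A₁ : (Fin n → Z) → (Fin k → Z)) (A₂ : (Fin k → Z) → Θ)
    (hcomp : ∀ S, A S = A₂ (A₁ S))
    (hsub : ∀ S, ∃ f : Fin k → Fin n, StrictMono f ∧ A₁ S = S ∘ f)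
    (Sm Sp : Fin n → Z) :
    rad ℓ (hatTheta A Sm Sp) Sp ≤
      Real.sqrt ((k : ℝ) * Real.log (2 * Real.exp 1 * n / k) / (2 * n)) := by
  have hn : 0 < n := hk.trans_le hkn
  have hn' : (0 : ℝ) < n := by exact_mod_cast hn
  have hk' : (0 : ℝ) < k := by exact_mod_cast hk
  have hkn' : (k : ℝ) ≤ n := by exact_mod_cast hkn
  have hbase : 1 < 2 * exp 1 * n / k := by
    rw [lt_div_iff₀ hk']
    nlinarith [add_one_le_exp (1 : ℝ)]
  have hq : 0 < (k : ℝ) * log (2 * exp 1 * n / k) / (2 * n) := by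
    have := log_pos hbase
    positivity
  set s := √((k : ℝ) * log (2 * exp 1 * n / k) / (2 * n)) with hs
  have hs0 : 0 < s := sqrt_pos.2 hq
  have hs2 : 2 * n * s ^ 2 = k * log (2 * exp 1 * n / k) := by
    rw [hs, sq_sqrt hq.le]
    field_simp
  let J := Finset.powersetCard k (Finset.univ : Finset (Fin n)) × (Fin k → Bool)
  let g : J → Θ := fun p => A₂ (mix (Sm ∘ p.1.1.orderEmbOfFin (Finset.mem_powersetCard.1 p.1.2).2)
    (Sp ∘ p.1.1.orderEmbOfFin (Finset.mem_powersetCard.1 p.1.2).2) p.2)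
  have hg : ∀ θ ∈ hatTheta A Sm Sp, ∃ j, g j = θ := by
    rintro _ ⟨σ, rfl⟩
    obtain ⟨f, hf, hA⟩ := hsub (mix Sm Sp σ)
    have hcard : (Finset.univ.image f).card = k := by
      rw [Finset.card_image_of_injective _ hf.injective, Finset.card_univ, Fintype.card_fin]
    have hfe : f = (Finset.univ.image f).orderEmbOfFin hcard :=
      Finset.orderEmbOfFin_unique hcard (fun x => Finset.mem_image_of_mem f (Finset.mem_univ x)) hf
    refine ⟨(⟨Finset.univ.image f,
      Finset.mem_powersetCard.2 ⟨Finset.subset_univ _, hcard⟩⟩, σ ∘ f), ?_⟩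
    change A₂ (mix (Sm ∘ (Finset.univ.image f).orderEmbOfFin hcard)
      (Sp ∘ (Finset.univ.image f).orderEmbOfFin hcard) (σ ∘ f)) = A (mix Sm Sp σ)
    rw [← hfe, hcomp, hA]
    rfl
  have hJ : (Fintype.card J : ℝ) ≤ exp (2 * n * s ^ 2) := by
    have hc : Fintype.card J = n.choose k * 2 ^ k := by
      simp [J]
    rw [hc, hs2, exp_nat_mul, exp_log (by linarith)]
    push_cast
    calc (n.choose k : ℝ) * 2 ^ k ≤ (exp 1 * n / k) ^ k * 2 ^ k := by
          gcongr
          exact choose_le_exp_one_mul_div_pow n hk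
      _ = (2 * exp 1 * n / k) ^ k := by
          rw [← mul_pow]
          ring_nf
  have hmain := massart_unitInterval (fun j i => ℓ (g j) (Sp i)) (fun j i => hrange _ _)
    (fun σ => sSup ((fun θ => ∑ i, (if σ i then (1 : ℝ) else -1) * ℓ θ (Sp i)) ''
      hatTheta A Sm Sp)) (fun σ => by
      have hmem := ((Set.range_nonempty fun τ => A (mix Sm Sp τ)).image _).csSup_mem
        ((Set.finite_range fun τ => A (mix Sm Sp τ)).image
        (fun θ => ∑ i, (if σ i then (1 : ℝ) else -1) * ℓ θ (Sp i)))
      obtain ⟨θ, hθ, he⟩ := hmem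
      obtain ⟨j, rfl⟩ := hg θ hθ
      exact ⟨j, he.ge⟩) hs0 hJ
  calc rad ℓ (hatTheta A Sm Sp) Sp ≤ (n : ℝ)⁻¹ * ((2 ^ n : ℝ)⁻¹ * (2 ^ n * (n * s))) := by
        unfold rad
        gcongr
    _ = s := by field_simp
end

section
/- Existence of optimal Steiner points: Let Θ̂ⁿ ⊂ ℝ^k (with the Euclidean metric d) be a finite non-focal set, and let 0 < ε < Δ(Θ̂ⁿ). Then there exists a finite set P ⊂ ℝ^k such that: (1) |P| ≤ |Θ̂ⁿ|; (2) ∇(Θ̂ⁿ ∪ P) ≤ ε and Δ(Θ̂ⁿ ∪ P) = Δ(Θ̂ⁿ); (3) N(Θ̂ⁿ, d, ε) = N(Θ̂ⁿ ∪ P, d, ε). -/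
open MeasureTheory Real

/-- Nearest-neighbour distance `ν_C(a) = min {d(a,b) : b ∈ C, b ≠ a}`. -/
noncomputable def nnDist {X : Type*} [PseudoMetricSpace X] (C : Set X) (a : X) : ℝ :=
  sInf ((fun b => dist a b) '' (C \ {a}))

/-- Covering diameter `∇(C) = max_{a ∈ C} ν_C(a)`. -/
noncomputable def covDiam {X : Type*} [PseudoMetricSpace X] (C : Set X) : ℝ :=
  sSup (nnDist C '' C)

/-- `ε`-covering number: minimal number of closed balls of radius `ε` needed to cover `C`. -/
noncomputable def coverNum {X : Type*} [PseudoMetricSpace X] (C : Set X) (ε : ℝ) : ℕ :=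
  sInf {m : ℕ | ∃ t : Finset X, t.card = m ∧ C ⊆ ⋃ x ∈ t, Metric.closedBall x ε}

theorem nnDist_le_dist {X : Type*} [PseudoMetricSpace X] {C : Set X} {a b : X}
    (hb : b ∈ C) (hba : b ≠ a) : nnDist C a ≤ dist a b := by
  refine csInf_le ⟨0, ?_⟩ ⟨b, ⟨hb, by simpa using hba⟩, rfl⟩
  rintro _ ⟨c, -, rfl⟩
  exact dist_nonneg

/-- The covering diameter is at most `ε` if every point has another point within `ε`. -/
theorem covDiam_le {X : Type*} [PseudoMetricSpace X] {C : Set X} {ε : ℝ} (hε : 0 ≤ ε)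
    (h : ∀ a ∈ C, ∃ b ∈ C, b ≠ a ∧ dist a b ≤ ε) : covDiam C ≤ ε := by
  refine Real.sSup_le ?_ hε
  rintro _ ⟨a, ha, rfl⟩
  obtain ⟨b, hb, hba, hab⟩ := h a ha
  exact (nnDist_le_dist hb hba).trans hab

theorem coverNum_le {X : Type*} [PseudoMetricSpace X] {C : Set X} {ε : ℝ} {t : Finset X}
    (h : C ⊆ ⋃ x ∈ t, Metric.closedBall x ε) : coverNum C ε ≤ t.card :=
  Nat.sInf_le ⟨t, rfl, h⟩

/-- A finite set has a cover by `ε`-balls of minimal cardinality. -/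
theorem exists_cover_card_eq_coverNum {X : Type*} [PseudoMetricSpace X] {C : Set X}
    (hC : C.Finite) {ε : ℝ} (hε : 0 ≤ ε) :
    ∃ t : Finset X, t.card = coverNum C ε ∧ C ⊆ ⋃ x ∈ t, Metric.closedBall x ε := by
  refine Nat.sInf_mem (s := {m : ℕ | ∃ t : Finset X, t.card = m ∧
    C ⊆ ⋃ x ∈ t, Metric.closedBall x ε}) ⟨_, hC.toFinset, rfl, fun x hx => ?_⟩
  exact Set.mem_biUnion (by simpa using hx) (Metric.mem_closedBall_self hε)

theorem coverNum_mono {X : Type*} [PseudoMetricSpace X] {C D : Set X} (hCD : C ⊆ D)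
    (hD : D.Finite) {ε : ℝ} (hε : 0 ≤ ε) : coverNum C ε ≤ coverNum D ε := by
  obtain ⟨t, ht, hDt⟩ := exists_cover_card_eq_coverNum hD hε
  exact ht ▸ coverNum_le (hCD.trans hDt)

section NormedSpace

variable {E : Type*} [NormedAddCommGroup E] [NormedSpace ℝ E]

theorem exists_mem_segment_ne_dist_le {a b : E} (hab : a ≠ b) {ε : ℝ} (hε : 0 < ε) :
    ∃ p ∈ segment ℝ a b, p ≠ a ∧ dist a p ≤ ε := by
  have hd : 0 < dist a b := dist_pos.2 hab
  have hr : 0 < min 1 (ε / dist a b) := lt_min one_pos (div_pos hε hd)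
  refine ⟨AffineMap.lineMap a b (min 1 (ε / dist a b)), ?_, ?_, ?_⟩
  · rw [segment_eq_image_lineMap]
    exact ⟨_, ⟨hr.le, min_le_left _ _⟩, rfl⟩
  · simp only [ne_eq, AffineMap.lineMap_eq_left_iff, not_or]
    exact ⟨hab, hr.ne'⟩
  · rw [dist_left_lineMap, Real.norm_of_nonneg hr.le]
    exact (le_div_iff₀ hd).1 (min_le_right _ _)

/-- A ball can be recentred, still covering the same points of `C`, so that each of those points
has another point of the convex hull of `C` both near it and in the new ball. -/
theorem exists_recentred_closedBall {C : Set E} (hC : C.Nontrivial) {ε : ℝ} (hε : 0 < ε) (x : E) :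
    ∃ y : E, ∀ a ∈ C, a ∈ Metric.closedBall x ε → a ∈ Metric.closedBall y ε ∧
      ∃ p ∈ convexHull ℝ C, p ≠ a ∧ dist a p ≤ ε ∧ p ∈ Metric.closedBall y ε := by
  by_cases h : ∃ a ∈ C, ∀ b ∈ C, b ∈ Metric.closedBall x ε → b = a
  · obtain ⟨a, ha, huniq⟩ := h
    refine ⟨a, fun b hb hbx => ?_⟩
    obtain rfl := huniq b hb hbx
    obtain ⟨c, hc, hcb⟩ := hC.exists_ne b
    obtain ⟨p, hp, hpb, hdist⟩ := exists_mem_segment_ne_dist_le hcb.symm hε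
    exact ⟨Metric.mem_closedBall_self hε.le, p, segment_subset_convexHull hb hc hp, hpb, hdist,
      Metric.mem_closedBall'.2 hdist⟩
  · push Not at h
    refine ⟨x, fun a ha hax => ⟨hax, ?_⟩⟩
    obtain ⟨b, hb, hbx, hba⟩ := h a ha
    obtain ⟨p, hp, hpa, hdist⟩ := exists_mem_segment_ne_dist_le hba.symm hε
    exact ⟨p, segment_subset_convexHull ha hb hp, hpa, hdist,
      (convex_closedBall x ε).segment_subset hax hbx hp⟩

end NormedSpace

/-- existence of optimal Steiner points.
For a finite non-focal set `Θ̂ⁿ ⊂ ℝᵏ` (Euclidean metric) and `0 < ε < Δ(Θ̂ⁿ)`, there is a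
finite set `P` with `|P| ≤ |Θ̂ⁿ|`, `∇(Θ̂ⁿ ∪ P) ≤ ε`, `Δ(Θ̂ⁿ ∪ P) = Δ(Θ̂ⁿ)`, and
`N(Θ̂ⁿ, d, ε) = N(Θ̂ⁿ ∪ P, d, ε)`. -/
theorem stmt_13 {k : ℕ} (C : Finset (EuclideanSpace ℝ (Fin k)))
    (hCnonfocal : covDiam (C : Set (EuclideanSpace ℝ (Fin k))) <
      Metric.diam (C : Set (EuclideanSpace ℝ (Fin k))))
    (ε : ℝ) (hε : 0 < ε) (hεΔ : ε < Metric.diam (C : Set (EuclideanSpace ℝ (Fin k)))) :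
    ∃ P : Finset (EuclideanSpace ℝ (Fin k)),
      P.card ≤ C.card ∧
      covDiam ((C : Set (EuclideanSpace ℝ (Fin k))) ∪ ↑P) ≤ ε ∧
      Metric.diam ((C : Set (EuclideanSpace ℝ (Fin k))) ∪ ↑P) =
        Metric.diam (C : Set (EuclideanSpace ℝ (Fin k))) ∧
      coverNum (C : Set (EuclideanSpace ℝ (Fin k))) ε =
        coverNum ((C : Set (EuclideanSpace ℝ (Fin k))) ∪ ↑P) ε := by
  classical
  have hC : (C : Set (EuclideanSpace ℝ (Fin k))).Nontrivial := by
    by_contra h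
    rw [Set.not_nontrivial_iff] at h
    linarith [Metric.diam_subsingleton h]
  obtain ⟨t, htcard, hCt⟩ := exists_cover_card_eq_coverNum C.finite_toSet hε.le
  choose y hy using exists_recentred_closedBall hC hε
  have hsteiner : ∀ a ∈ C, ∃ p ∈ convexHull ℝ (C : Set (EuclideanSpace ℝ (Fin k))),
      p ≠ a ∧ dist a p ≤ ε ∧
        {a, p} ⊆ ⋃ x ∈ t.image y, Metric.closedBall x ε := by
    intro a ha
    obtain ⟨x, hx, hax⟩ := Set.mem_iUnion₂.1 (hCt ha)
    obtain ⟨hay, p, hp, hpa, hdist, hpy⟩ := hy x a ha hax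
    refine ⟨p, hp, hpa, hdist, ?_⟩
    rw [Set.pair_subset_iff]
    exact ⟨Set.mem_biUnion (Finset.mem_image_of_mem y hx) hay,
      Set.mem_biUnion (Finset.mem_image_of_mem y hx) hpy⟩
  choose! p hp hpa hdist hcov using hsteiner
  have hfin : ((C : Set (EuclideanSpace ℝ (Fin k))) ∪ ↑(C.image p)).Finite :=
    C.finite_toSet.union (C.image p).finite_toSet
  refine ⟨C.image p, Finset.card_image_le, covDiam_le hε.le ?_, le_antisymm ?_ ?_,
    le_antisymm (coverNum_mono Set.subset_union_left hfin hε.le) ?_⟩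
  · rintro a (ha | ha)
    · exact ⟨p a, Or.inr (Finset.mem_coe.2 (Finset.mem_image_of_mem p ha)), hpa a ha, hdist a ha⟩
    · obtain ⟨b, hb, rfl⟩ := Finset.mem_image.1 (Finset.mem_coe.1 ha)
      exact ⟨b, Or.inl hb, (hpa b hb).symm, dist_comm b (p b) ▸ hdist b hb⟩
  · rw [← convexHull_diam (C : Set (EuclideanSpace ℝ (Fin k)))]
    refine Metric.diam_mono (Set.union_subset (subset_convexHull ℝ _) ?_)
      (isBounded_convexHull.2 C.finite_toSet.isBounded)
    intro q hq
    obtain ⟨a, ha, rfl⟩ := Finset.mem_image.1 (Finset.mem_coe.1 hq)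
    exact hp a ha
  · exact Metric.diam_mono Set.subset_union_left hfin.isBounded
  · refine (coverNum_le (t := t.image y) ?_).trans (Finset.card_image_le.trans htcard.le)
    rintro q (hq | hq)
    · exact hcov q hq (Set.mem_insert _ _)
    · obtain ⟨a, ha, rfl⟩ := Finset.mem_image.1 (Finset.mem_coe.1 hq)
      exact hcov a ha (Set.mem_insert_of_mem _ rfl)
end

section
/- In-expectation generalization bound for compression schemes: Suppose A : Z^n → Θ is a k-compression scheme (A(S^n) = A₂(A₁(S^n)) with A₁ selecting a size-k subsample of its input and A₂ deterministic), losses take values in [0,1], and S^n ∼ D^n is an i.i.d. sample with θ̂ = A(S^n). Then E_{S^n}[ R(θ̂) − R̂(θ̂, S^n) ] ≤ 2·√( k·log(2en/k) / (2n) ). -/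
open MeasureTheory Real

lemma sum_exp_sign_mul_le {ι : Type*} [Fintype ι] [DecidableEq ι] (a : ι → ℝ)
    (ha : ∀ i, |a i| ≤ 1) (t : ℝ) :
    ∑ σ : ι → Bool, exp (t * ∑ i, (if σ i then -1 else 1) * a i) ≤
      2 ^ Fintype.card ι * exp (Fintype.card ι * (t ^ 2 / 2)) := by
  have hfactor (i : ι) :
      ∑ b : Bool, exp (t * ((if b then -1 else 1) * a i)) ≤ 2 * exp (t ^ 2 / 2) := by
    have hsq : (t * a i) ^ 2 ≤ t ^ 2 := by
      have := (sq_le_one_iff_abs_le_one (a i)).2 (ha i)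
      nlinarith [sq_nonneg t]
    have hcosh : cosh (t * a i) ≤ exp (t ^ 2 / 2) :=
      (cosh_le_exp_half_sq _).trans (exp_le_exp.2 (by linarith))
    rw [cosh_eq] at hcosh
    simp only [Fintype.sum_bool, if_true, Bool.false_eq_true, if_false, neg_mul, one_mul, mul_neg]
    linarith
  calc
    _ = ∏ i : ι, ∑ b : Bool, exp (t * ((if b then -1 else 1) * a i)) := by
      rw [Finset.prod_univ_sum, Fintype.piFinset_univ]
      simp_rw [Finset.mul_sum, exp_sum]
    _ ≤ ∏ _i : ι, 2 * exp (t ^ 2 / 2) :=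
      Finset.prod_le_prod (fun _ _ ↦ by positivity) fun i _ ↦ hfactor i
    _ = _ := by
      rw [Finset.prod_const, Finset.card_univ, mul_pow, ← exp_nat_mul]

/-- Massart's finite class lemma, stated for an arbitrary selection `τ` from the class. -/
lemma sum_sign_mul_le_of_card_le {T ι : Type*} [Fintype T] [Fintype ι] [DecidableEq ι] [Nonempty ι]
    (a : T → ι → ℝ) (ha : ∀ t i, |a t i| ≤ 1) {L : ℝ} (hL : 0 < L)
    (hcard : (Fintype.card T : ℝ) ≤ exp L) (τ : (ι → Bool) → T) :
    ∑ σ : ι → Bool, ∑ i, (if σ i then -1 else 1) * a (τ σ) i ≤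
      2 ^ Fintype.card ι * √(2 * Fintype.card ι * L) := by
  have hn' : (0 : ℝ) < Fintype.card ι := by exact_mod_cast Fintype.card_pos
  set n : ℝ := (Fintype.card ι : ℝ)
  set r : ℝ := √(2 * L / n) with hr
  have hr0 : 0 < r := sqrt_pos.2 (by positivity)
  have hr2 : n * (r ^ 2 / 2) = L := by
    rw [hr, sq_sqrt (by positivity)]
    field_simp
  have hrL : r * √(2 * n * L) = 2 * L := by
    rw [hr, ← sqrt_mul (by positivity), sqrt_eq_iff_mul_self_eq (by positivity) (by positivity)]
    field_simp
  have hexp : ∑ σ : ι → Bool, exp (r * ∑ i, (if σ i then -1 else 1) * a (τ σ) i) ≤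
      2 ^ Fintype.card ι * exp (2 * L) :=
    calc
      _ ≤ ∑ σ : ι → Bool, ∑ t, exp (r * ∑ i, (if σ i then -1 else 1) * a t i) :=
        Finset.sum_le_sum fun σ _ ↦ Finset.single_le_sum
          (f := fun t ↦ exp (r * ∑ i, (if σ i then -1 else 1) * a t i))
          (fun _ _ ↦ (exp_pos _).le) (Finset.mem_univ (τ σ))
      _ = ∑ t, ∑ σ : ι → Bool, exp (r * ∑ i, (if σ i then -1 else 1) * a t i) :=
        Finset.sum_comm
      _ ≤ ∑ _t : T, 2 ^ Fintype.card ι * exp L :=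
        Finset.sum_le_sum fun t _ ↦ (sum_exp_sign_mul_le (a t) (ha t) r).trans_eq (by rw [hr2])
      _ = Fintype.card T * (2 ^ Fintype.card ι * exp L) := by
        rw [Finset.sum_const, Finset.card_univ, nsmul_eq_mul]
      _ ≤ exp L * (2 ^ Fintype.card ι * exp L) := by gcongr
      _ = _ := by rw [two_mul, exp_add]; ring
  refine le_of_mul_le_mul_left ?_ hr0
  calc
    _ = ∑ σ : ι → Bool, r * ∑ i, (if σ i then -1 else 1) * a (τ σ) i := Finset.mul_sum ..
    _ ≤ ∑ σ : ι → Bool, (2 * L - 1 +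
        exp (-(2 * L)) * exp (r * ∑ i, (if σ i then -1 else 1) * a (τ σ) i)) := by
      refine Finset.sum_le_sum fun σ _ ↦ ?_
      rw [← exp_add]
      linarith [add_one_le_exp (-(2 * L) + r * ∑ i, (if σ i then -1 else 1) * a (τ σ) i)]
    _ = 2 ^ Fintype.card ι * (2 * L - 1) +
        exp (-(2 * L)) * ∑ σ : ι → Bool, exp (r * ∑ i, (if σ i then -1 else 1) * a (τ σ) i) := by
      rw [Finset.sum_add_distrib, ← Finset.mul_sum, Finset.sum_const, nsmul_eq_mul, Finset.card_univ]
      simp only [Fintype.card_fun, Fintype.card_bool, Nat.cast_pow, Nat.cast_ofNat]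
    _ ≤ 2 ^ Fintype.card ι * (2 * L - 1) +
        exp (-(2 * L)) * (2 ^ Fintype.card ι * exp (2 * L)) := by gcongr
    _ = 2 ^ Fintype.card ι * (2 * L) := by
      rw [mul_left_comm (exp _), ← exp_add, neg_add_cancel, exp_zero]
      ring
    _ = _ := by rw [← hrL]; ring

lemma choose_mul_two_pow_le_exp {n k : ℕ} (hn : 0 < n) (hk : 0 < k) :
    (n.choose k * 2 ^ k : ℝ) ≤ exp (k * log (2 * exp 1 * n / k)) := by
  have hk' : (0 : ℝ) < k := by exact_mod_cast hk
  have hn' : (0 : ℝ) < n := by exact_mod_cast hn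
  have hfact := pow_div_factorial_le_exp (x := (k : ℝ)) hk'.le k
  calc
    (n.choose k * 2 ^ k : ℝ) ≤ n ^ k / k.factorial * 2 ^ k := by
      gcongr
      exact Nat.choose_le_pow_div k n
    _ = (2 * n / k) ^ k * (k ^ k / k.factorial) := by
      rw [div_pow, mul_pow]
      field_simp
    _ ≤ (2 * n / k) ^ k * exp k := by gcongr
    _ = (2 * exp 1 * n / k) ^ k := by
      rw [← exp_one_pow k, ← mul_pow]
      congr 1
      ring
    _ = _ := by rw [exp_nat_mul, exp_log (by positivity)]

lemma measurable_risk_s16 {Θ Z : Type*} [MeasurableSpace Z] [MeasurableSpace Θ] (D : Measure Z)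
    [SFinite D] {ℓ : Θ → Z → ℝ} (hℓ : Measurable (Function.uncurry ℓ)) : Measurable (risk ℓ D) :=
  hℓ.stronglyMeasurable.integral_prod_right.measurable

/-- Exchange the coordinates of the pairs `W i` for which `σ i` is true. -/
def swapAt {ι Z : Type*} (σ : ι → Bool) (W : ι → Z × Z) (i : ι) : Z × Z :=
  if σ i then (W i).swap else W i

lemma measurePreserving_swapAt {ι Z : Type*} [Fintype ι] [MeasurableSpace Z] (D : Measure Z)
    [SigmaFinite D] (σ : ι → Bool) :
    MeasurePreserving (swapAt σ) (Measure.pi fun _ : ι ↦ D.prod D)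
      (Measure.pi fun _ : ι ↦ D.prod D) := by
  refine measurePreserving_pi (fun _ ↦ D.prod D) (fun _ ↦ D.prod D)
    (f := fun i p ↦ if σ i then p.swap else p) fun i ↦ ?_
  cases σ i
  · exact MeasurePreserving.id (D.prod D)
  · simpa using Measure.measurePreserving_swap (μ := D) (ν := D)

lemma measurePreserving_fst_pi {ι Z : Type*} [Fintype ι] [MeasurableSpace Z] (D : Measure Z)
    [IsProbabilityMeasure D] :
    MeasurePreserving (fun (W : ι → Z × Z) i ↦ (W i).1) (Measure.pi fun _ : ι ↦ D.prod D)
      (Measure.pi fun _ : ι ↦ D) :=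
  measurePreserving_pi (fun _ ↦ D.prod D) (fun _ ↦ D) (f := fun _ ↦ Prod.fst)
    fun _ ↦ measurePreserving_fst

lemma measurePreserving_fst_pi_snd_eval {ι Z : Type*} [Fintype ι] [MeasurableSpace Z]
    (D : Measure Z) [IsProbabilityMeasure D] (j : ι) :
    MeasurePreserving (fun W : ι → Z × Z ↦ ((fun i ↦ (W i).1), (W j).2))
      (Measure.pi fun _ : ι ↦ D.prod D) ((Measure.pi fun _ : ι ↦ D).prod D) :=
  ((MeasurePreserving.id _).prod (measurePreserving_eval (fun _ : ι ↦ D) j)).comp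
    (measurePreserving_arrowProdEquivProdArrow Z Z ι (fun _ ↦ D) fun _ ↦ D)

/-- The difference between the empirical risks on a ghost sample and on the training sample of
the hypothesis trained on the latter. -/
noncomputable def ghostGap {Θ Z : Type*} (ℓ : Θ → Z → ℝ) {n : ℕ} (A : (Fin n → Z) → Θ)
    (W : Fin n → Z × Z) : ℝ :=
  empRisk ℓ (A fun i ↦ (W i).1) (fun i ↦ (W i).2) - empRisk ℓ (A fun i ↦ (W i).1) fun i ↦ (W i).1

section Symmetrization

variable {Θ Z : Type*} [MeasurableSpace Z] [MeasurableSpace Θ] (D : Measure Z)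
  [IsProbabilityMeasure D] {n : ℕ} {ℓ : Θ → Z → ℝ} {A : (Fin n → Z) → Θ}

lemma integrable_of_mem_Icc {Ω : Type*} [MeasurableSpace Ω] {μ : Measure Ω} [IsFiniteMeasure μ]
    {f : Ω → ℝ} (hf : Measurable f) (h : ∀ x, f x ∈ Set.Icc (0 : ℝ) 1) : Integrable f μ :=
  Integrable.of_mem_Icc 0 1 hf.aemeasurable (Filter.Eventually.of_forall h)

lemma risk_mem_Icc (hℓ : Measurable (Function.uncurry ℓ))
    (hrange : ∀ θ z, ℓ θ z ∈ Set.Icc (0 : ℝ) 1) (θ : Θ) : risk ℓ D θ ∈ Set.Icc (0 : ℝ) 1 := by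
  refine ⟨integral_nonneg fun z ↦ (hrange θ z).1, ?_⟩
  have hint : Integrable (ℓ θ) D := integrable_of_mem_Icc hℓ.of_uncurry_left (hrange θ)
  simpa [risk] using integral_mono (μ := D) hint (integrable_const 1) fun z ↦ (hrange θ z).2

lemma measurable_ghostGap (hℓ : Measurable (Function.uncurry ℓ)) (hA : Measurable A) :
    Measurable (ghostGap ℓ A) := by
  have hθ : Measurable fun W : Fin n → Z × Z ↦ A fun i ↦ (W i).1 := hA.comp (by fun_prop)
  refine Measurable.sub ?_ ?_ <;>
  · refine Measurable.const_mul (Finset.measurable_sum _ fun i _ ↦ ?_) _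
    exact hℓ.comp (hθ.prodMk (by fun_prop))

lemma integrable_loss_snd (hℓ : Measurable (Function.uncurry ℓ))
    (hrange : ∀ θ z, ℓ θ z ∈ Set.Icc (0 : ℝ) 1) (hA : Measurable A) (j : Fin n) :
    Integrable (fun W : Fin n → Z × Z ↦ ℓ (A fun i ↦ (W i).1) (W j).2)
      (Measure.pi fun _ ↦ D.prod D) :=
  integrable_of_mem_Icc (hℓ.comp ((hA.comp (by fun_prop)).prodMk (by fun_prop)))
    fun _ ↦ hrange _ _

lemma integrable_loss_fst (hℓ : Measurable (Function.uncurry ℓ))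
    (hrange : ∀ θ z, ℓ θ z ∈ Set.Icc (0 : ℝ) 1) (hA : Measurable A) (j : Fin n) :
    Integrable (fun S : Fin n → Z ↦ ℓ (A S) (S j)) (Measure.pi fun _ ↦ D) :=
  integrable_of_mem_Icc (hℓ.comp (hA.prodMk (by fun_prop))) fun _ ↦ hrange _ _

lemma integrable_empRisk_s16 (hℓ : Measurable (Function.uncurry ℓ))
    (hrange : ∀ θ z, ℓ θ z ∈ Set.Icc (0 : ℝ) 1) (hA : Measurable A) :
    Integrable (fun S : Fin n → Z ↦ empRisk ℓ (A S) S) (Measure.pi fun _ ↦ D) :=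
  (integrable_finsetSum _ fun j _ ↦ integrable_loss_fst D hℓ hrange hA j).const_mul _

lemma integrable_empRisk_ghost (hℓ : Measurable (Function.uncurry ℓ))
    (hrange : ∀ θ z, ℓ θ z ∈ Set.Icc (0 : ℝ) 1) (hA : Measurable A) :
    Integrable (fun W : Fin n → Z × Z ↦ empRisk ℓ (A fun i ↦ (W i).1) fun i ↦ (W i).2)
      (Measure.pi fun _ ↦ D.prod D) :=
  (integrable_finsetSum _ fun j _ ↦ integrable_loss_snd D hℓ hrange hA j).const_mul _

lemma integrable_ghostGap (hℓ : Measurable (Function.uncurry ℓ))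
    (hrange : ∀ θ z, ℓ θ z ∈ Set.Icc (0 : ℝ) 1) (hA : Measurable A) :
    Integrable (ghostGap ℓ A) (Measure.pi fun _ ↦ D.prod D) :=
  (integrable_empRisk_ghost D hℓ hrange hA).sub
    ((measurePreserving_fst_pi D).integrable_comp_of_integrable
      (integrable_empRisk_s16 D hℓ hrange hA))

lemma integral_loss_snd (hℓ : Measurable (Function.uncurry ℓ))
    (hrange : ∀ θ z, ℓ θ z ∈ Set.Icc (0 : ℝ) 1) (hA : Measurable A) (j : Fin n) :
    ∫ W, ℓ (A fun i ↦ (W i).1) (W j).2 ∂(Measure.pi fun _ : Fin n ↦ D.prod D) =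
      ∫ S, risk ℓ D (A S) ∂(Measure.pi fun _ : Fin n ↦ D) := by
  have hmeas : Measurable fun p : (Fin n → Z) × Z ↦ ℓ (A p.1) p.2 :=
    hℓ.comp ((hA.comp measurable_fst).prodMk measurable_snd)
  have hmp := measurePreserving_fst_pi_snd_eval D j
  calc
    _ = ∫ p, ℓ (A p.1) p.2 ∂((Measure.pi fun _ : Fin n ↦ D).prod D) := by
      rw [← hmp.map_eq, integral_map hmp.aemeasurable hmeas.aestronglyMeasurable]
    _ = _ := integral_prod _ (integrable_of_mem_Icc hmeas fun _ ↦ hrange _ _)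

lemma integral_risk_sub_empRisk (hn : 0 < n) (hℓ : Measurable (Function.uncurry ℓ))
    (hrange : ∀ θ z, ℓ θ z ∈ Set.Icc (0 : ℝ) 1) (hA : Measurable A) :
    ∫ S, (risk ℓ D (A S) - empRisk ℓ (A S) S) ∂(Measure.pi fun _ : Fin n ↦ D) =
      ∫ W, ghostGap ℓ A W ∂(Measure.pi fun _ : Fin n ↦ D.prod D) := by
  have hn' : (n : ℝ) ≠ 0 := by exact_mod_cast hn.ne'
  have hmp := measurePreserving_fst_pi (ι := Fin n) D
  have hemp := integrable_empRisk_s16 D hℓ hrange hA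
  have hfst : ∫ W, empRisk ℓ (A fun i ↦ (W i).1) (fun i ↦ (W i).1)
      ∂(Measure.pi fun _ : Fin n ↦ D.prod D) =
      ∫ S, empRisk ℓ (A S) S ∂(Measure.pi fun _ : Fin n ↦ D) := by
    conv_rhs => rw [← hmp.map_eq]
    exact (integral_map hmp.aemeasurable
      (by rw [hmp.map_eq]; exact hemp.aestronglyMeasurable)).symm
  have hsnd : ∫ W, empRisk ℓ (A fun i ↦ (W i).1) (fun i ↦ (W i).2)
      ∂(Measure.pi fun _ : Fin n ↦ D.prod D) =
      ∫ S, risk ℓ D (A S) ∂(Measure.pi fun _ : Fin n ↦ D) := by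
    simp only [empRisk]
    rw [integral_const_mul, integral_finsetSum _ fun j _ ↦ integrable_loss_snd D hℓ hrange hA j]
    simp only [integral_loss_snd D hℓ hrange hA, Finset.sum_const, Finset.card_univ,
      Fintype.card_fin, nsmul_eq_mul]
    rw [inv_mul_cancel_left₀ hn']
  have hrisk : Integrable (fun S ↦ risk ℓ D (A S)) (Measure.pi fun _ : Fin n ↦ D) :=
    integrable_of_mem_Icc ((measurable_risk_s16 D hℓ).comp hA) fun _ ↦ risk_mem_Icc D hℓ hrange _
  rw [integral_sub hrisk hemp, ← hfst, ← hsnd]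
  exact (integral_sub (integrable_empRisk_ghost D hℓ hrange hA)
    (hmp.integrable_comp_of_integrable hemp)).symm

lemma integral_ghostGap_le_of_sum_swapAt_le (hℓ : Measurable (Function.uncurry ℓ))
    (hrange : ∀ θ z, ℓ θ z ∈ Set.Icc (0 : ℝ) 1) (hA : Measurable A) {B : ℝ}
    (hB : ∀ W, ∑ σ : Fin n → Bool, ghostGap ℓ A (swapAt σ W) ≤ 2 ^ n * B) :
    ∫ W, ghostGap ℓ A W ∂(Measure.pi fun _ : Fin n ↦ D.prod D) ≤ B := by
  have hint := integrable_ghostGap D hℓ hrange hA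
  have hswap (σ : Fin n → Bool) :
      ∫ W, ghostGap ℓ A (swapAt σ W) ∂(Measure.pi fun _ : Fin n ↦ D.prod D) =
        ∫ W, ghostGap ℓ A W ∂(Measure.pi fun _ : Fin n ↦ D.prod D) := by
    have hmp := measurePreserving_swapAt D σ
    conv_rhs => rw [← hmp.map_eq]
    exact (integral_map hmp.aemeasurable (measurable_ghostGap hℓ hA).aestronglyMeasurable).symm
  have hint_swap (σ : Fin n → Bool) : Integrable (fun W ↦ ghostGap ℓ A (swapAt σ W))
      (Measure.pi fun _ : Fin n ↦ D.prod D) :=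
    (measurePreserving_swapAt D σ).integrable_comp_of_integrable hint
  have hmono := integral_mono (integrable_finsetSum Finset.univ fun σ _ ↦ hint_swap σ)
    (integrable_const (2 ^ n * B)) hB
  rw [integral_finsetSum _ fun σ _ ↦ hint_swap σ] at hmono
  simp only [hswap, Finset.sum_const, Finset.card_univ, Fintype.card_pi, Fintype.card_bool,
    Finset.prod_const, Fintype.card_fin, nsmul_eq_mul, Nat.cast_pow, Nat.cast_ofNat,
    integral_const, probReal_univ, one_smul] at hmono
  exact le_of_mul_le_mul_left hmono (by positivity)

end Symmetrization

lemma ghostGap_swapAt {Θ Z : Type*} (ℓ : Θ → Z → ℝ) {n : ℕ} (A : (Fin n → Z) → Θ)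
    (σ : Fin n → Bool) (W : Fin n → Z × Z) :
    ghostGap ℓ A (swapAt σ W) = (n : ℝ)⁻¹ * ∑ i, (if σ i then -1 else 1) *
      (ℓ (A fun i ↦ (swapAt σ W i).1) (W i).2 - ℓ (A fun i ↦ (swapAt σ W i).1) (W i).1) := by
  rw [ghostGap, empRisk, empRisk, ← mul_sub, ← Finset.sum_sub_distrib]
  congr 1
  refine Finset.sum_congr rfl fun i _ ↦ ?_
  generalize A (fun i ↦ (swapAt σ W i).1) = θ
  cases h : σ i <;> simp [swapAt, h]

/-- The `k`-subsample of the supersample `W` with index set `s`, taking the second coordinate of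
the `j`-th selected pair when `b j` is true. -/
def supersampleSelect {Z : Type*} {n k : ℕ} (W : Fin n → Z × Z)
    (c : {s : Finset (Fin n) // s.card = k} × (Fin k → Bool)) (j : Fin k) : Z :=
  if c.2 j then (W (c.1.1.orderEmbOfFin c.1.2 j)).2 else (W (c.1.1.orderEmbOfFin c.1.2 j)).1

lemma exists_supersampleSelect_eq {Z : Type*} {n k : ℕ} (W : Fin n → Z × Z) (σ : Fin n → Bool)
    {f : Fin k → Fin n} (hf : StrictMono f) :
    ∃ c, (fun i ↦ (swapAt σ W i).1) ∘ f = supersampleSelect W c := by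
  have hcard : (Finset.univ.image f).card = k := by
    rw [Finset.card_image_of_injective _ hf.injective, Finset.card_univ, Fintype.card_fin]
  refine ⟨(⟨Finset.univ.image f, hcard⟩, σ ∘ f), ?_⟩
  have hemb : f = (Finset.univ.image f).orderEmbOfFin hcard :=
    Finset.orderEmbOfFin_unique hcard (fun x ↦ Finset.mem_image_of_mem f (Finset.mem_univ x)) hf
  funext j
  simp only [supersampleSelect, ← hemb, Function.comp_apply, swapAt]
  split_ifs <;> rfl

lemma sum_ghostGap_swapAt_le {Θ Z : Type*} {n k : ℕ} (hk : 0 < k) (hkn : k ≤ n)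
    {ℓ : Θ → Z → ℝ} (hrange : ∀ θ z, ℓ θ z ∈ Set.Icc (0 : ℝ) 1) {A : (Fin n → Z) → Θ}
    {A₁ : (Fin n → Z) → (Fin k → Z)} {A₂ : (Fin k → Z) → Θ} (hcomp : ∀ S, A S = A₂ (A₁ S))
    (hsub : ∀ S, ∃ f : Fin k → Fin n, StrictMono f ∧ A₁ S = S ∘ f) (W : Fin n → Z × Z) :
    ∑ σ : Fin n → Bool, ghostGap ℓ A (swapAt σ W) ≤
      2 ^ n * (2 * √((k : ℝ) * log (2 * exp 1 * n / k) / (2 * n))) := by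
  have hn : 0 < n := hk.trans_le hkn
  have hk' : (0 : ℝ) < k := by exact_mod_cast hk
  have hn' : (0 : ℝ) < n := by exact_mod_cast hn
  have : Nonempty (Fin n) := ⟨⟨0, hn⟩⟩
  have hlog : 0 < log (2 * exp 1 * n / k) := by
    refine log_pos ((one_lt_div hk').2 ?_)
    have hkn' : (k : ℝ) ≤ n := by exact_mod_cast hkn
    nlinarith [add_one_le_exp (1 : ℝ)]
  set L : ℝ := k * log (2 * exp 1 * n / k) with hLdef
  have hL : 0 < L := by positivity
  have hselect (σ : Fin n → Bool) :
      ∃ c, A (fun i ↦ (swapAt σ W i).1) = A₂ (supersampleSelect W c) := by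
    obtain ⟨f, hf, hAf⟩ := hsub fun i ↦ (swapAt σ W i).1
    obtain ⟨c, hc⟩ := exists_supersampleSelect_eq W σ hf
    exact ⟨c, by rw [hcomp, hAf, hc]⟩
  choose τ hτ using hselect
  have hcard : (Fintype.card ({s : Finset (Fin n) // s.card = k} × (Fin k → Bool)) : ℝ) ≤
      exp L := by
    have := choose_mul_two_pow_le_exp hn hk
    simpa [Fintype.card_finset_len] using this
  have hmassart := sum_sign_mul_le_of_card_le
    (fun c i ↦ ℓ (A₂ (supersampleSelect W c)) (W i).2 - ℓ (A₂ (supersampleSelect W c)) (W i).1)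
    (fun c i ↦ abs_sub_le_iff.2
      ⟨by linarith [(hrange (A₂ (supersampleSelect W c)) (W i).2).2,
        (hrange (A₂ (supersampleSelect W c)) (W i).1).1],
      by linarith [(hrange (A₂ (supersampleSelect W c)) (W i).1).2,
        (hrange (A₂ (supersampleSelect W c)) (W i).2).1]⟩) hL hcard τ
  rw [Fintype.card_fin] at hmassart
  have hsqrt : (n : ℝ)⁻¹ * √(2 * n * L) = 2 * √(L / (2 * n)) := by
    rw [show 2 * n * L = (2 * n) ^ 2 * (L / (2 * n)) by field_simp,
      sqrt_mul (by positivity), sqrt_sq (by positivity)]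
    field_simp
  simp only [ghostGap_swapAt, hτ, ← Finset.mul_sum]
  calc
    _ ≤ (n : ℝ)⁻¹ * (2 ^ n * √(2 * n * L)) := by gcongr
    _ = _ := by rw [mul_left_comm, hsqrt]

/-- in-expectation generalization bound for compression schemes.
If `A = A₂ ∘ A₁` is a `k`-compression scheme (`A₁` selects a size-`k` subsample, `A₂` is
deterministic), losses take values in `[0,1]`, and `Sⁿ ~ Dⁿ` with `θ̂ = A(Sⁿ)`, then
`E_{Sⁿ}[R(θ̂) − R̂(θ̂, Sⁿ)] ≤ 2 √(k log(2en/k)/(2n))`. -/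
theorem stmt_16 {Θ Z : Type*} [MeasurableSpace Z] [MeasurableSpace Θ]
    (D : Measure Z) [IsProbabilityMeasure D] (n k : ℕ) (hk : 0 < k) (hkn : k ≤ n)
    (ℓ : Θ → Z → ℝ) (hℓmeas : Measurable (Function.uncurry ℓ))
    (hrange : ∀ θ z, ℓ θ z ∈ Set.Icc (0 : ℝ) 1)
    (A : (Fin n → Z) → Θ) (hA : Measurable A)
    (A₁ : (Fin n → Z) → (Fin k → Z)) (A₂ : (Fin k → Z) → Θ)
    (hcomp : ∀ S, A S = A₂ (A₁ S))
    (hsub : ∀ S, ∃ f : Fin k → Fin n, StrictMono f ∧ A₁ S = S ∘ f) :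
    ∫ S, (risk ℓ D (A S) - empRisk ℓ (A S) S) ∂(Measure.pi fun _ : Fin n => D) ≤
      2 * Real.sqrt ((k : ℝ) * Real.log (2 * Real.exp 1 * n / k) / (2 * n)) := by
  rw [integral_risk_sub_empRisk D (hk.trans_le hkn) hℓmeas hrange hA]
  exact integral_ghostGap_le_of_sum_swapAt_le D hℓmeas hrange hA
    (sum_ghostGap_swapAt_le hk hkn hrange hcomp hsub)
end
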